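/- arXiv:1001.0556 — 5 statements merged into one kernel-verified Lean document; each statement's English description precedes it below -/
import Mathlib

section
/- Let m ≥ 2 be an integer, h > 0 and p ∈ ℝ. The series ∑_{β∈ℤ} D_m[β]·exp(2πi·h·p·β) converges absolutely, and (∑_{β∈ℤ} D_m[β]·exp(2πi·h·p·β)) · (2·∑_{k=0}^{m-2} a_k^{(2m-2)}·cos(2π·h·p·(m−1−k)) + a_{m-1}^{(2m-2)}) = (−1)^m·2^{2m}·(2m−1)!·h^{−2m}·sin^{2m}(π·h·p). In particular, whenever the second factor is nonzero, ∑_{β∈ℤ} D_m[β]·exp(2πi·h·p·β) = (−1)^m·2^{2m}·(2m−1)!·h^{−2m}·sin^{2m}(π·h·p) / (2·∑_{k=0}^{m-2} a_k^{(2m-2)}·cos(2π·h·p·(m−1−k)) + a_{m-1}^{(2m-2)}). -/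
/-- The Euler–Frobenius coefficient `a_s^{(k)}`. -/
noncomputable def eulerCoeff (k s : ℕ) : ℝ :=
  ∑ j ∈ Finset.range (s + 1),
    (-1 : ℝ) ^ j * (Nat.choose (k + 2) j : ℝ) * ((s + 1 - j : ℕ) : ℝ) ^ (k + 1)

/-- The Euler–Frobenius polynomial `E_k`. -/
noncomputable def eulerPoly (k : ℕ) : Polynomial ℝ :=
  ∑ s ∈ Finset.range (k + 1), Polynomial.C (eulerCoeff k s) * Polynomial.X ^ s

/-- The set `Λ` of real roots of `E_{2m-2}` of modulus less than `1`. -/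
noncomputable def smallRoots (m : ℕ) : Finset ℝ :=
  (eulerPoly (2 * m - 2)).roots.toFinset.filter (fun x => |x| < 1)

/-- The discrete analogue `D_m[β]` of the operator `d^{2m}/dx^{2m}`. -/
noncomputable def Dm (m : ℕ) (h : ℝ) (β : ℤ) : ℝ :=
  (((2 * m - 1).factorial : ℝ) / h ^ (2 * m)) *
    (if β = 0 then
      -(2 : ℝ) ^ (2 * m - 1) +
        ∑ l ∈ smallRoots m, (1 - l) ^ (2 * m + 1) / (l * (eulerPoly (2 * m - 1)).eval l)
    else if β.natAbs = 1 then
      1 + ∑ l ∈ smallRoots m, (1 - l) ^ (2 * m + 1) / (eulerPoly (2 * m - 1)).eval l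
    else
      ∑ l ∈ smallRoots m,
        (1 - l) ^ (2 * m + 1) * l ^ β.natAbs / (l * (eulerPoly (2 * m - 1)).eval l))

open Polynomial in
theorem coeff_one_sub_X_pow' (N s : ℕ) :
    ((1 - X : ℝ[X]) ^ N).coeff s = (-1) ^ s * (N.choose s : ℝ) := by
  induction N generalizing s with
  | zero => cases s <;> simp [coeff_one]
  | succ N ih =>
    cases s with
    | zero => simp [coeff_zero_eq_eval_zero]
    | succ s =>
      rw [pow_succ, mul_sub, mul_one, coeff_sub, coeff_mul_X, ih, ih, Nat.choose_succ_succ]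
      push_cast
      ring

section Series
open PowerSeries

/-- The power series `(1 - X)^(n+1) * ∑ (j+1)^n X^j`. -/
noncomputable def eulerSeries (n : ℕ) : ℝ⟦X⟧ :=
  (1 - X) ^ (n + 1) * mk fun j : ℕ => ((j : ℝ) + 1) ^ n

theorem coeff_eulerSeries_succ (k s : ℕ) :
    coeff s (eulerSeries (k + 1)) = eulerCoeff k s := by
  have h : ((1 - X : ℝ⟦X⟧) ^ (k + 1 + 1)) =
      ((1 - Polynomial.X : Polynomial ℝ) ^ (k + 2) : Polynomial ℝ) := by
    simp
  rw [eulerSeries, h, coeff_mul, Finset.Nat.sum_antidiagonal_eq_sum_range_succ_mk, eulerCoeff]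
  refine Finset.sum_congr rfl fun j hj => ?_
  have hj' : j ≤ s := by simpa [Nat.lt_succ_iff] using hj
  rw [Polynomial.coeff_coe, coeff_one_sub_X_pow', coeff_mk]
  congr 2
  rw [show s + 1 - j = (s - j) + 1 by omega]
  push_cast
  rfl

theorem eulerSeries_zero : eulerSeries 0 = 1 := by
  simpa [eulerSeries, mul_comm, Pi.one_def] using mk_one_mul_one_sub_eq_one ℝ

theorem eulerSeries_succ (n : ℕ) :
    eulerSeries (n + 1) = (1 + (n : ℝ⟦X⟧) * X) * eulerSeries n
      + X * (1 - X) * d⁄dX ℝ (eulerSeries n) := by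
  have h : (mk fun j : ℕ => ((j : ℝ) + 1) ^ (n + 1)) =
      (mk fun j : ℕ => ((j : ℝ) + 1) ^ n) + X * d⁄dX ℝ (mk fun j : ℕ => ((j : ℝ) + 1) ^ n) := by
    ext j
    cases j with
    | zero => simp
    | succ j =>
      rw [map_add, coeff_succ_X_mul, coeff_derivative]
      simp only [coeff_mk]
      push_cast
      ring
  simp only [eulerSeries]
  rw [h, Derivation.leibniz, derivative_pow]
  simp only [map_sub, derivative_X, smul_eq_mul, derivative_one, Nat.add_sub_cancel]
  push_cast
  ring

theorem eulerSeries_one : eulerSeries 1 = 1 := by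
  rw [eulerSeries_succ, eulerSeries_zero]
  simp

theorem eulerCoeff_zero_left (s : ℕ) : eulerCoeff 0 s = if s = 0 then 1 else 0 := by
  rw [← coeff_eulerSeries_succ, eulerSeries_one, coeff_one]

theorem eulerCoeff_zero_right (k : ℕ) : eulerCoeff k 0 = 1 := by
  simp [eulerCoeff]

theorem eulerCoeff_one_right (k : ℕ) : eulerCoeff k 1 = 2 ^ (k + 1) - (k + 2) := by
  simp [eulerCoeff, Finset.sum_range_succ]
  ring

theorem eulerCoeff_succ_succ (k s : ℕ) :
    eulerCoeff (k + 1) (s + 1) =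
      ((s : ℝ) + 2) * eulerCoeff k (s + 1) + ((k : ℝ) + 1 - s) * eulerCoeff k s := by
  have h := congrArg (coeff (s + 1)) (eulerSeries_succ (k + 1))
  rw [show (1 + ((k + 1 : ℕ) : ℝ⟦X⟧) * X) * eulerSeries (k + 1)
      + X * (1 - X) * d⁄dX ℝ (eulerSeries (k + 1)) = eulerSeries (k + 1) +
        X * (C ((k + 1 : ℕ) : ℝ) * eulerSeries (k + 1) + d⁄dX ℝ (eulerSeries (k + 1))
          - X * d⁄dX ℝ (eulerSeries (k + 1))) by rw [map_natCast]; ring] at h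
  rw [map_add, coeff_succ_X_mul, map_sub, map_add, coeff_C_mul, coeff_derivative] at h
  simp only [coeff_eulerSeries_succ] at h
  rw [h]
  cases s with
  | zero => 
    simp
    ring
  | succ s =>
    rw [coeff_succ_X_mul, coeff_derivative, coeff_eulerSeries_succ]
    push_cast
    ring

theorem eulerCoeff_eq_zero {k s : ℕ} (h : k < s) : eulerCoeff k s = 0 := by
  induction k generalizing s with
  | zero => simp [eulerCoeff_zero_left, h.ne']
  | succ k ih =>
    obtain ⟨s, rfl⟩ : ∃ t, s = t + 1 := ⟨s - 1, by omega⟩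
    rw [eulerCoeff_succ_succ, ih (by omega), ih (by omega)]
    simp

theorem eulerCoeff_symm {k s t : ℕ} (h : s + t = k) : eulerCoeff k s = eulerCoeff k t := by
  induction k generalizing s t with
  | zero =>
    obtain ⟨rfl, rfl⟩ : s = 0 ∧ t = 0 := by omega
    rfl
  | succ k ih =>
    have h0 : eulerCoeff k k = 1 := by rw [ih (add_zero k), eulerCoeff_zero_right]
    have hk : eulerCoeff (k + 1) (k + 1) = 1 := by
      rw [eulerCoeff_succ_succ, eulerCoeff_eq_zero (Nat.lt_succ_self k), h0]
      ring
    rcases s with _ | s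
    · obtain rfl : t = k + 1 := by omega
      rw [hk, eulerCoeff_zero_right]
    rcases t with _ | t
    · obtain rfl : s = k := by omega
      rw [hk, eulerCoeff_zero_right]
    obtain rfl : k = s + t + 1 := by omega
    rw [eulerCoeff_succ_succ _ s, eulerCoeff_succ_succ _ t, ih (s := s + 1) (t := t) (by omega),
      ih (s := s) (t := t + 1) (by omega)]
    push_cast
    ring

end Series

section EulerPoly
open Polynomial

theorem coeff_eulerPoly (k s : ℕ) : (eulerPoly k).coeff s = eulerCoeff k s := by
  simp only [eulerPoly, finsetSum_coeff, coeff_C_mul, coeff_X_pow, mul_ite, mul_one, mul_zero,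
    Finset.sum_ite_eq, Finset.mem_range]
  split_ifs with h
  · rfl
  · exact (eulerCoeff_eq_zero (by omega)).symm

theorem natDegree_eulerPoly (k : ℕ) : (eulerPoly k).natDegree = k := by
  refine natDegree_eq_of_le_of_coeff_ne_zero ?_ ?_
  · rw [natDegree_le_iff_coeff_eq_zero]
    intro s hs
    rw [coeff_eulerPoly, eulerCoeff_eq_zero hs]
  · rw [coeff_eulerPoly, eulerCoeff_symm (add_zero k), eulerCoeff_zero_right]
    exact one_ne_zero

theorem monic_eulerPoly (k : ℕ) : (eulerPoly k).Monic := by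
  rw [Monic, leadingCoeff, natDegree_eulerPoly, coeff_eulerPoly, eulerCoeff_symm (add_zero k),
    eulerCoeff_zero_right]

theorem eval_zero_eulerPoly (k : ℕ) : (eulerPoly k).eval 0 = 1 := by
  rw [← coeff_zero_eq_eval_zero, coeff_eulerPoly, eulerCoeff_zero_right]

theorem coe_eulerPoly (k : ℕ) : (eulerPoly k : PowerSeries ℝ) = eulerSeries (k + 1) := by
  ext s
  rw [coeff_coe, coeff_eulerPoly, coeff_eulerSeries_succ]

theorem eulerPoly_zero : eulerPoly 0 = 1 := by
  simp [eulerPoly, eulerCoeff_zero_right]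

theorem eulerPoly_succ (k : ℕ) :
    eulerPoly (k + 1) = (1 + ((k + 1 : ℕ) : ℝ[X]) * X) * eulerPoly k
      + X * (1 - X) * derivative (eulerPoly k) := by
  apply Polynomial.coe_injective
  rw [coe_eulerPoly, eulerSeries_succ, ← coe_eulerPoly, PowerSeries.derivative_coe]
  have h (n : ℕ) : ((n : ℝ[X]) : PowerSeries ℝ) = n :=
    map_natCast (coeToPowerSeries.ringHom (R := ℝ)) n
  simp [-Nat.cast_add, h]

theorem eulerPoly_eval_inv (k : ℕ) {x : ℝ} (hx : x ≠ 0) :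
    x ^ k * (eulerPoly k).eval x⁻¹ = (eulerPoly k).eval x := by
  simp only [eulerPoly, eval_finsetSum, eval_mul, eval_C, eval_pow, eval_X]
  rw [← Finset.sum_range_reflect, Finset.mul_sum]
  refine Finset.sum_congr rfl fun s hs => ?_
  have hs' : s ≤ k := by simpa [Nat.lt_succ_iff] using hs
  rw [show k + 1 - 1 - s = k - s by omega, eulerCoeff_symm (show k - s + s = k by omega), inv_pow,
    pow_sub₀ x hx hs']
  field_simp

theorem eval_one_eulerPoly (k : ℕ) : (eulerPoly k).eval 1 = ((k + 1).factorial : ℝ) := by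
  induction k with
  | zero => simp [eulerPoly_zero]
  | succ k ih =>
    rw [eulerPoly_succ, Nat.factorial_succ (k + 1)]
    simp only [eval_add, eval_mul, eval_one, eval_X, eval_natCast, eval_sub, ih]
    push_cast
    ring

theorem eval_derivative_eulerPoly {k : ℕ} {x : ℝ} (h : (eulerPoly k).eval x = 0) :
    x * (1 - x) * (derivative (eulerPoly k)).eval x = (eulerPoly (k + 1)).eval x := by
  simp [eulerPoly_succ, h]

/-- The polynomials `U₀ = 1 - X²`, `Uₖ₊₁ = (1 - X²) Uₖ'` giving the iterated derivatives
of `tanh`. -/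
noncomputable def tanhPoly : ℕ → ℝ[X]
  | 0 => 1 - X ^ 2
  | k + 1 => (1 - X ^ 2) * derivative (tanhPoly k)

theorem tanhPoly_ne_zero (k : ℕ) : tanhPoly k ≠ 0 ∧
    (tanhPoly k).eval 1 = 0 ∧ (tanhPoly k).eval (-1) = 0 ∧
    (derivative (tanhPoly k)).eval 1 ≠ 0 ∧ (derivative (tanhPoly k)).eval (-1) ≠ 0 := by
  suffices h : (tanhPoly k).eval 1 = 0 ∧ (tanhPoly k).eval (-1) = 0 ∧
    (derivative (tanhPoly k)).eval 1 ≠ 0 ∧ (derivative (tanhPoly k)).eval (-1) ≠ 0 by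
    refine ⟨fun h0 => h.2.2.1 (by simp [h0]), h⟩
  induction k with
  | zero => simp [tanhPoly]
  | succ k ih => simp [tanhPoly, ih]

theorem le_card_roots_tanhPoly (k : ℕ) : k + 2 ≤ (tanhPoly k).roots.toFinset.card := by
  induction k with
  | zero =>
    have h : ({1, -1} : Finset ℝ) ⊆ (tanhPoly 0).roots.toFinset := by
      intro x hx
      have := tanhPoly_ne_zero 0
      simp only [Finset.mem_insert, Finset.mem_singleton] at hx
      rw [Multiset.mem_toFinset, mem_roots this.1, IsRoot]
      rcases hx with rfl | rfl
      exacts [this.2.1, this.2.2.1]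
    refine le_trans ?_ (Finset.card_le_card h)
    rw [Finset.card_pair (by norm_num)]
  | succ k ih =>
    obtain ⟨-, -, -, h1, h2⟩ := tanhPoly_ne_zero k
    have h0 := (tanhPoly_ne_zero (k + 1)).1
    have hd : derivative (tanhPoly k) ≠ 0 := fun h => h1 (by simp [h])
    have hsub : insert 1 (insert (-1) (derivative (tanhPoly k)).roots.toFinset) ⊆
        (tanhPoly (k + 1)).roots.toFinset := by
      intro x hx
      simp only [Finset.mem_insert, Multiset.mem_toFinset, mem_roots hd, IsRoot] at hx
      rw [Multiset.mem_toFinset, mem_roots h0, IsRoot, tanhPoly]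
      rcases hx with rfl | rfl | hx
      · simp
      · simp
      · simp [hx]
    have hc := Finset.card_le_card hsub
    rw [Finset.card_insert_of_notMem, Finset.card_insert_of_notMem] at hc
    · have := card_roots_toFinset_le_derivative (tanhPoly k)
      omega
    · simp [hd, h2]
    · simp [hd, h1]
      norm_num

theorem eval_tanhPoly (k : ℕ) {x : ℝ} (hx : x ≠ 1) :
    (tanhPoly k).eval ((1 + x) / (1 - x)) =
      -4 * (-2) ^ k * (x * (eulerPoly k).eval x) / (1 - x) ^ (k + 2) := by
  induction k generalizing x with
  | zero =>
    have : 1 - x ≠ 0 := sub_ne_zero.2 hx.symm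
    simp [tanhPoly, eulerPoly_zero]
    field_simp
    ring
  | succ k ih =>
    have h1 : 1 - x ≠ 0 := sub_ne_zero.2 hx.symm
    have hs : HasDerivAt (fun y : ℝ => 1 - y) (-1) x := by
      simpa using (hasDerivAt_id x).const_sub 1
    have ha : HasDerivAt (fun y : ℝ => 1 + y) 1 x := by
      simpa using (hasDerivAt_id x).const_add 1
    have hl := ((tanhPoly k).hasDerivAt ((1 + x) / (1 - x))).comp x (ha.div hs h1)
    have hr := ((((hasDerivAt_id x).mul ((eulerPoly k).hasDerivAt x)).const_mul
      (-4 * (-2) ^ k)).div (hs.pow (k + 2)) (pow_ne_zero _ h1))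
    have he := hl.unique (hr.congr_of_eventuallyEq
      ((eventually_ne_nhds hx).mono fun y hy => ih hy))
    have h2 : (derivative (tanhPoly k)).eval ((1 + x) / (1 - x)) * 2 =
      -4 * (-2) ^ k * (eulerPoly (k + 1)).eval x / (1 - x) ^ (k + 1) := by
      rw [eulerPoly_succ]
      simp [-mul_eq_mul_right_iff, -mul_eq_mul_left_iff] at he ⊢
      field_simp at he ⊢
      refine mul_right_cancel₀ (pow_ne_zero (k + 3) h1) ?_
      linear_combination he
    rw [tanhPoly, eval_mul]
    have h3 : (1 - X ^ 2 : ℝ[X]).eval ((1 + x) / (1 - x)) = -4 * x / (1 - x) ^ 2 := by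
      simp
      field_simp
      ring
    rw [h3, eq_div_of_mul_eq two_ne_zero h2]
    field_simp
    ring


theorem card_roots_eulerPoly (k : ℕ) : (eulerPoly k).roots.toFinset.card = k := by
  refine le_antisymm ?_ ?_
  · calc _ ≤ Multiset.card (eulerPoly k).roots := Multiset.toFinset_card_le _
      _ ≤ (eulerPoly k).natDegree := card_roots' _
      _ = k := natDegree_eulerPoly k
  · have hsub : (((tanhPoly k).roots.toFinset.erase (-1)).erase 1).image
        (fun y => (y - 1) / (y + 1)) ⊆ (eulerPoly k).roots.toFinset := by
      intro x hx
      simp only [Finset.mem_image, Finset.mem_erase, Multiset.mem_toFinset,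
        mem_roots (tanhPoly_ne_zero k).1, IsRoot] at hx
      obtain ⟨y, ⟨hy1, hy2, hy⟩, rfl⟩ := hx
      have h1 : y + 1 ≠ 0 := fun h => hy2 (eq_neg_of_add_eq_zero_left h)
      have h2 : y - 1 ≠ 0 := sub_ne_zero.2 hy1
      have hx1 : (y - 1) / (y + 1) ≠ 1 := by
        rw [Ne, div_eq_one_iff_eq h1]
        intro h
        linarith
      have h := eval_tanhPoly k hx1
      have hy' : (1 + (y - 1) / (y + 1)) / (1 - (y - 1) / (y + 1)) = y := by
        field_simp
        ring
      rw [hy', hy, eq_comm, div_eq_zero_iff] at h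
      rw [Multiset.mem_toFinset, mem_roots (monic_eulerPoly k).ne_zero, IsRoot]
      simpa [h1, h2, sub_ne_zero.2 hx1.symm] using h
    refine le_trans ?_ (Finset.card_le_card hsub)
    rw [Finset.card_image_of_injOn]
    · have := le_card_roots_tanhPoly k
      have h1 := Finset.pred_card_le_card_erase (s := (tanhPoly k).roots.toFinset) (a := -1)
      have h2 := Finset.pred_card_le_card_erase
        (s := (tanhPoly k).roots.toFinset.erase (-1)) (a := 1)
      omega
    · intro y hy z hz h
      simp only [Finset.coe_erase, Set.mem_sdiff, Set.mem_singleton_iff] at hy hz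
      have h1 : y + 1 ≠ 0 := fun h => hy.1.2 (eq_neg_of_add_eq_zero_left h)
      have h2 : z + 1 ≠ 0 := fun h => hz.1.2 (eq_neg_of_add_eq_zero_left h)
      simp only [div_eq_div_iff h1 h2] at h
      linarith

theorem eulerPoly_eq_nodal (k : ℕ) :
    eulerPoly k = Lagrange.nodal (eulerPoly k).roots.toFinset id := by
  have h := card_roots_eulerPoly k
  have h1 : Multiset.card (eulerPoly k).roots = (eulerPoly k).natDegree := by
    refine le_antisymm (card_roots' _) ?_
    rw [natDegree_eulerPoly]
    exact h.ge.trans (Multiset.toFinset_card_le _)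
  have h2 : (eulerPoly k).roots.Nodup := by
    rw [← Multiset.toFinset_card_eq_card_iff_nodup, h, h1, natDegree_eulerPoly]
  conv_lhs => rw [← prod_multiset_X_sub_C_of_monic_of_roots_card_eq (monic_eulerPoly k) h1]
  rw [Lagrange.nodal_eq, Finset.prod, Multiset.toFinset_val, h2.dedup]
  rfl

theorem eval_derivative_eulerPoly_ne_zero {k : ℕ} {r : ℝ} (hr : (eulerPoly k).eval r = 0) :
    (derivative (eulerPoly k)).eval r ≠ 0 := by
  have hm : r ∈ (eulerPoly k).roots.toFinset := by
    rw [Multiset.mem_toFinset, mem_roots (monic_eulerPoly k).ne_zero, IsRoot, hr]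
  have h := Lagrange.nodalWeight_eq_eval_derivative_nodal (v := (id : ℝ → ℝ)) hm
  rw [← eulerPoly_eq_nodal] at h
  intro h0
  exact Lagrange.nodalWeight_ne_zero (Function.injective_id.injOn) hm (by rw [h, id, h0, inv_zero])

theorem eulerPoly_root_ne {k : ℕ} {r : ℝ} (hr : (eulerPoly k).eval r = 0) : r ≠ 0 ∧ r ≠ 1 := by
  constructor
  · rintro rfl
    simp [eval_zero_eulerPoly] at hr
  · rintro rfl
    rw [eval_one_eulerPoly] at hr
    exact Nat.cast_ne_zero.2 (Nat.factorial_ne_zero _) hr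

theorem eulerPoly_inv_root {k : ℕ} {r : ℝ} (hr : (eulerPoly k).eval r = 0) :
    (eulerPoly k).eval r⁻¹ = 0 := by
  have h := eulerPoly_eval_inv k (eulerPoly_root_ne hr).1
  rw [hr] at h
  exact (mul_eq_zero.1 h).resolve_left (pow_ne_zero _ (eulerPoly_root_ne hr).1)

theorem eval_neg_one_eulerPoly_ne_zero {k : ℕ} (hk : Even k) : (eulerPoly k).eval (-1) ≠ 0 := by
  intro h
  have h1 := eulerPoly_eval_inv (k + 1) (x := -1) (by norm_num)
  rw [hk.add_one.neg_one_pow, inv_neg, inv_one] at h1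
  have h2 := eval_derivative_eulerPoly h
  have h3 := eval_derivative_eulerPoly_ne_zero h
  apply h3
  linarith

theorem degree_eulerPoly_remainder {k : ℕ} (hk : 1 ≤ k) (he : Even k) :
    ((1 - X) ^ (k + 2) - (X ^ 2 - C (2 ^ (k + 1)) * X + 1) * eulerPoly k : ℝ[X]).degree
      < (k + 1 : ℕ) := by
  rw [degree_lt_iff_coeff_zero]
  intro s hs
  have hd : ((1 - X) ^ (k + 2) - (X ^ 2 - C (2 ^ (k + 1)) * X + 1) * eulerPoly k : ℝ[X]).natDegree
      ≤ k + 2 := by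
    have := natDegree_eulerPoly k
    compute_degree
    omega
  obtain ⟨t, rfl⟩ : ∃ t, s = t + 2 := ⟨s - 2, by omega⟩
  have h1 : eulerCoeff k k = 1 := by rw [eulerCoeff_symm (add_zero k), eulerCoeff_zero_right]
  rcases lt_or_ge (k + 2) (t + 2) with h | h
  · exact coeff_eq_zero_of_natDegree_lt (hd.trans_lt h)
  rw [coeff_sub, coeff_one_sub_X_pow', add_mul, sub_mul, coeff_add, coeff_sub, mul_assoc,
    coeff_C_mul, coeff_X_mul, one_mul, coeff_X_pow_mul, coeff_eulerPoly, coeff_eulerPoly,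
    coeff_eulerPoly]
  obtain rfl | rfl : t = k ∨ k = t + 1 := by omega
  · rw [h1, eulerCoeff_eq_zero (by omega : t < t + 1), eulerCoeff_eq_zero (by omega : t < t + 2)]
    simp [he.neg_one_pow, pow_add]
  · rw [h1, eulerCoeff_eq_zero (by omega : t + 1 < t + 2),
      eulerCoeff_symm (rfl : t + 1 = t + 1), eulerCoeff_one_right]
    have ht : Odd t := by simpa [Nat.even_add_one] using he
    rw [Nat.choose_symm_of_eq_add (show t + 1 + 2 = (t + 2) + 1 by ring), Nat.choose_one_right]
    simp [ht.neg_one_pow, pow_add]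

/-- Partial fraction decomposition of `(1 - z) ^ (k + 2) / (z * E_k(z))`. -/
theorem one_sub_pow_eq_eulerPoly_mul {k : ℕ} (hk : 1 ≤ k) (he : Even k) {z : ℂ}
    (hz : ∀ r ∈ (eulerPoly k).roots.toFinset, z ≠ (r : ℂ)) :
    (1 - z) ^ (k + 2) = aeval z (eulerPoly k) * (z ^ 2 - 2 ^ (k + 1) * z + 1 +
      z * ∑ r ∈ (eulerPoly k).roots.toFinset,
        (((1 - r) ^ (k + 3) / (eulerPoly (k + 1)).eval r : ℝ) : ℂ) / (z - r)) := by
  set R := (eulerPoly k).roots.toFinset with hR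
  set N : ℝ[X] := (1 - X) ^ (k + 2) - (X ^ 2 - C (2 ^ (k + 1)) * X + 1) * eulerPoly k with hN
  have hroot {r : ℝ} (hr : r ∈ R) : (eulerPoly k).eval r = 0 :=
    ((mem_roots (monic_eulerPoly k).ne_zero).1 (Multiset.mem_toFinset.1 hr))
  have hN0 : N = X * N.divX := by
    conv_lhs => rw [← X_mul_divX_add N]
    simp [hN, coeff_zero_eq_eval_zero, eval_zero_eulerPoly]
  have hcast (p : ℝ[X]) (r : ℝ) :
      eval (r : ℂ) (p.map Complex.ofRealHom) = ((p.eval r : ℝ) : ℂ) := by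
    rw [eval_map]
    exact eval₂_at_apply Complex.ofRealHom r
  have hv : Set.InjOn ((↑) : ℝ → ℂ) R := Complex.ofReal_injective.injOn
  have hnodal : Lagrange.nodal R ((↑) : ℝ → ℂ) = (eulerPoly k).map Complex.ofRealHom := by
    rw [eulerPoly_eq_nodal k, Lagrange.nodal_eq, Lagrange.nodal_eq, Polynomial.map_prod]
    simp [hR]
  have hdeg : (N.divX.map Complex.ofRealHom).degree < (R.card : ℕ) := by
    rw [hR, card_roots_eulerPoly, degree_map]
    have h : N.degree < (k + 1 : ℕ) := degree_eulerPoly_remainder hk he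
    rw [degree_lt_iff_coeff_zero] at h ⊢
    intro s hs
    rw [coeff_divX]
    exact h _ (by omega)
  have hM := Lagrange.eq_interpolate_of_eval_eq
    (fun r : ℝ => ((N.divX.eval r : ℝ) : ℂ)) hv hdeg (fun r _ => hcast _ r)
  have h1 := congrArg (eval z) hM
  rw [Lagrange.eval_interpolate_not_at_node _ hz, hnodal] at h1
  have h2 : aeval z N = z * aeval z N.divX := by
    conv_lhs => rw [hN0]
    simp
  have h3 : aeval z N =
      (1 - z) ^ (k + 2) - (z ^ 2 - 2 ^ (k + 1) * z + 1) * aeval z (eulerPoly k) := by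
    simp [hN]
  rw [eval_map, eval_map] at h1
  change aeval z N.divX = aeval z (eulerPoly k) * _ at h1
  have h4 :
      ∑ r ∈ R, Lagrange.nodalWeight R ((↑) : ℝ → ℂ) r * (z - r)⁻¹ * ((N.divX.eval r : ℝ) : ℂ) =
      ∑ r ∈ R, (((1 - r) ^ (k + 3) / (eulerPoly (k + 1)).eval r : ℝ) : ℂ) / (z - r) := by
    refine Finset.sum_congr rfl fun r hr => ?_
    rw [Lagrange.nodalWeight_eq_eval_derivative_nodal hr, hnodal, derivative_map,
      ← eval_derivative_eulerPoly (hroot hr)]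
    have h5 : (1 - r) ^ (k + 2) = r * N.divX.eval r := by
      have h := congrArg (eval r) hN0
      rw [eval_mul, eval_X] at h
      rw [← h]
      simp [hN, hroot hr]
    have h6 := eulerPoly_root_ne (hroot hr)
    have h7 : 1 - r ≠ 0 := sub_ne_zero.2 h6.2.symm
    have h8 := eval_derivative_eulerPoly_ne_zero (hroot hr)
    have h9 : (1 - r) ^ (k + 3) / (r * (1 - r) * (derivative (eulerPoly k)).eval r) =
        ((derivative (eulerPoly k)).eval r)⁻¹ * N.divX.eval r := by
      rw [pow_succ, h5]
      field_simp [h6.1]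
    rw [h9, hcast]
    push_cast
    ring
  rw [h4] at h1
  linear_combination h3.symm.trans h2 + z * h1

end EulerPoly

theorem hasSum_int_geometric {l z : ℂ} (hl : ‖l‖ < 1) (hz : ‖z‖ = 1) :
    HasSum (fun β : ℤ => l ^ β.natAbs * z ^ β) ((1 - l * z)⁻¹ + l * z⁻¹ * (1 - l * z⁻¹)⁻¹) := by
  have hz0 : z ≠ 0 := norm_ne_zero_iff.1 (by simp [hz])
  refine HasSum.of_nat_of_neg_add_one ?_ ?_
  · simpa [mul_pow] using hasSum_geometric_of_norm_lt_one (ξ := l * z) (by simpa [hz] using hl)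
  · have h := (hasSum_geometric_of_norm_lt_one (ξ := l * z⁻¹) (by simpa [hz] using hl)).mul_left
      (l * z⁻¹)
    refine h.congr_fun fun j => ?_
    rw [show (-((j : ℤ) + 1)).natAbs = j + 1 by omega, zpow_neg,
      show (j : ℤ) + 1 = ((j + 1 : ℕ) : ℤ) by simp, zpow_natCast, ← inv_pow, ← mul_pow, pow_succ']

theorem sum_roots_eulerPoly {n : ℕ} (f : ℝ → ℂ) :
    ∑ r ∈ (eulerPoly (2 * n)).roots.toFinset, f r =
      ∑ l ∈ smallRoots (n + 1), (f l + f l⁻¹) := by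
  have h0 : eulerPoly (2 * n) ≠ 0 := (monic_eulerPoly _).ne_zero
  have hmem (r : ℝ) : r ∈ smallRoots (n + 1) ↔ (eulerPoly (2 * n)).eval r = 0 ∧ |r| < 1 := by
    simp [smallRoots, Nat.mul_succ, h0]
  have hu : (eulerPoly (2 * n)).roots.toFinset =
      smallRoots (n + 1) ∪ (smallRoots (n + 1)).image (·⁻¹) := by
    ext r
    simp only [Multiset.mem_toFinset, Polynomial.mem_roots h0, Polynomial.IsRoot, Finset.mem_union,
      Finset.mem_image, hmem]
    constructor
    · intro hr
      obtain ⟨hr0, hr1⟩ := eulerPoly_root_ne hr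
      rcases lt_trichotomy |r| 1 with h | h | h
      · exact Or.inl ⟨hr, h⟩
      · rcases eq_or_eq_neg_of_abs_eq h with rfl | rfl
        · exact absurd rfl hr1
        · exact absurd hr (eval_neg_one_eulerPoly_ne_zero (even_two_mul n))
      · refine Or.inr ⟨r⁻¹, ⟨eulerPoly_inv_root hr, ?_⟩, inv_inv r⟩
        rw [abs_inv]
        exact inv_lt_one_of_one_lt₀ h
    · rintro (h | ⟨l, ⟨h, -⟩, rfl⟩)
      exacts [h.1, eulerPoly_inv_root h]
  rw [hu, Finset.sum_union, Finset.sum_image inv_injective.injOn, Finset.sum_add_distrib]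
  rw [Finset.disjoint_left]
  intro r hr hr'
  obtain ⟨l, hl, rfl⟩ := Finset.mem_image.1 hr'
  rw [hmem] at hr hl
  have := eulerPoly_root_ne hl.1
  have h1 : 1 < |l|⁻¹ := (one_lt_inv₀ (abs_pos.2 this.1)).2 hl.2
  rw [abs_inv] at hr
  linarith [hr.2]

theorem Dm_succ (n : ℕ) (h : ℝ) (β : ℤ) :
    Dm (n + 1) h β = ((2 * n + 1).factorial / h ^ (2 * n + 2)) *
      ((if β = 0 then -2 ^ (2 * n + 1) else 0) + (if β = 1 then 1 else 0) +
        (if β = -1 then 1 else 0) + ∑ l ∈ smallRoots (n + 1),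
          (1 - l) ^ (2 * n + 3) / (eulerPoly (2 * n + 1)).eval l / l * l ^ β.natAbs) := by
  have hl0 {l : ℝ} (hl : l ∈ smallRoots (n + 1)) : l ≠ 0 := by
    rw [smallRoots, Finset.mem_filter, Multiset.mem_toFinset] at hl
    exact (eulerPoly_root_ne (Polynomial.isRoot_of_mem_roots hl.1)).1
  rw [Dm, show 2 * (n + 1) - 1 = 2 * n + 1 by omega, show 2 * (n + 1) = 2 * n + 2 by ring,
    show 2 * n + 2 + 1 = 2 * n + 3 by ring]
  congr 1
  by_cases h0 : β = 0
  · subst h0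
    simp [div_div, mul_comm]
  by_cases h1 : β.natAbs = 1
  · have h2 : ((if β = 1 then 1 else 0) + (if β = -1 then 1 else 0) : ℝ) = 1 := by
      rcases Int.natAbs_eq_iff.1 h1 with rfl | rfl <;> simp
    rw [if_neg h0, if_pos h1, if_neg h0, h1, zero_add, h2]
    congr 1
    refine Finset.sum_congr rfl fun l hl => ?_
    rw [pow_one, div_mul_cancel₀ _ (hl0 hl)]
  · rw [if_neg h0, if_neg h1, if_neg h0, if_neg (by rintro rfl; simp at h1),
      if_neg (by rintro rfl; simp at h1)]
    simp only [zero_add]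
    refine Finset.sum_congr rfl fun l hl => ?_
    rw [div_div, mul_comm l, div_mul_eq_mul_div]

theorem hasSum_Dm {n : ℕ} (hn : 1 ≤ n) (h : ℝ) {z : ℂ} (hz : ‖z‖ = 1) :
    ∃ S : ℂ, HasSum (fun β : ℤ => (Dm (n + 1) h β : ℂ) * z ^ β) S ∧
      S * (z * Polynomial.aeval z (eulerPoly (2 * n))) =
        ((2 * n + 1).factorial / h ^ (2 * n + 2)) * (1 - z) ^ (2 * n + 2) := by
  have hz0 : z ≠ 0 := norm_ne_zero_iff.1 (by simp [hz])
  have hmem {l : ℝ} (hl : l ∈ smallRoots (n + 1)) :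
      (eulerPoly (2 * n)).eval l = 0 ∧ |l| < 1 := by
    rw [smallRoots, Finset.mem_filter, Multiset.mem_toFinset] at hl
    exact ⟨Polynomial.isRoot_of_mem_roots hl.1, hl.2⟩
  let K : ℝ → ℝ := fun l => (1 - l) ^ (2 * n + 3) / (eulerPoly (2 * n + 1)).eval l
  have hsingle (a : ℤ) (c : ℂ) :
      HasSum (fun β : ℤ => (if β = a then c else 0) * z ^ β) (c * z ^ a) := by
    convert hasSum_single a ?_ using 1
    · simp
    · intro β hβ
      simp [hβ]
  have hroots : HasSum (fun β : ℤ => ∑ l ∈ smallRoots (n + 1),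
      ((K l / l : ℝ) : ℂ) * ((l : ℂ) ^ β.natAbs * z ^ β))
      (∑ l ∈ smallRoots (n + 1),
        ((K l / l : ℝ) : ℂ) * ((1 - l * z)⁻¹ + l * z⁻¹ * (1 - l * z⁻¹)⁻¹)) :=
    hasSum_sum fun l hl => (hasSum_int_geometric (by simpa using (hmem hl).2) hz).mul_left _
  have hs := (((((hsingle 0 (-2 ^ (2 * n + 1))).add (hsingle 1 1)).add (hsingle (-1) 1)).add
    hroots).mul_left (((2 * n + 1).factorial / h ^ (2 * n + 2) : ℂ)))
  refine ⟨_, hs.congr_fun fun β => ?_, ?_⟩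
  · rw [Dm_succ]
    push_cast
    rw [mul_assoc, add_mul, add_mul, add_mul, Finset.sum_mul]
    simp only [mul_assoc, K, apply_ite Complex.ofReal]
    push_cast
    rfl
  have hne : ∀ r ∈ (eulerPoly (2 * n)).roots.toFinset, z ≠ (r : ℂ) := by
    rintro r hr rfl
    have hr := Polynomial.isRoot_of_mem_roots (Multiset.mem_toFinset.1 hr)
    rw [Complex.norm_real, Real.norm_eq_abs] at hz
    rcases eq_or_eq_neg_of_abs_eq hz with rfl | rfl
    · exact (eulerPoly_root_ne hr).2 rfl
    · exact eval_neg_one_eulerPoly_ne_zero (even_two_mul n) hr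
  rw [one_sub_pow_eq_eulerPoly_mul (by omega) (even_two_mul n) hne, sum_roots_eulerPoly]
  have hpair : ∀ l ∈ smallRoots (n + 1),
      ((K l : ℝ) : ℂ) / (z - l) + ((K l⁻¹ : ℝ) : ℂ) / (z - (l⁻¹ : ℝ)) =
      ((K l / l : ℝ) : ℂ) * ((1 - l * z)⁻¹ + l * z⁻¹ * (1 - l * z⁻¹)⁻¹) := by
    intro l hl
    obtain ⟨hl1, hl2⟩ := hmem hl
    obtain ⟨h0, h1⟩ := eulerPoly_root_ne hl1
    have hK : K l⁻¹ = - K l / l ^ 2 := by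
      have he := eulerPoly_eval_inv (2 * n + 1) h0
      have hE : (eulerPoly (2 * n + 1)).eval l ≠ 0 := by
        rw [← eval_derivative_eulerPoly hl1]
        exact mul_ne_zero (mul_ne_zero h0 (sub_ne_zero.2 h1.symm))
          (eval_derivative_eulerPoly_ne_zero hl1)
      have hE' : (eulerPoly (2 * n + 1)).eval l⁻¹ ≠ 0 := by
        rintro h
        rw [h, mul_zero] at he
        exact hE he.symm
      have hp : (1 - l⁻¹) ^ (2 * n + 3) = - (1 - l) ^ (2 * n + 3) / l ^ (2 * n + 3) := by
        rw [← Odd.neg_pow (by use n + 1; ring), ← div_pow]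
        congr 1
        field_simp
        ring
      simp only [K]
      rw [hp, ← he]
      field_simp
      ring
    have ha : z - l ≠ 0 := sub_ne_zero.2 (hne l (by
      rw [Multiset.mem_toFinset, Polynomial.mem_roots (monic_eulerPoly _).ne_zero]; exact hl1))
    have hb : z - ((l⁻¹ : ℝ) : ℂ) ≠ 0 := sub_ne_zero.2 (hne l⁻¹ (by
      rw [Multiset.mem_toFinset, Polynomial.mem_roots (monic_eulerPoly _).ne_zero]
      exact eulerPoly_inv_root hl1))
    have hl0 : (l : ℂ) ≠ 0 := Complex.ofReal_ne_zero.2 h0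
    have hc : 1 - l * z ≠ 0 := by
      intro h
      apply hb
      rw [Complex.ofReal_inv, sub_eq_zero, ← mul_right_inj' hl0, mul_inv_cancel₀ hl0]
      linear_combination -h
    have hd : 1 - l * z⁻¹ ≠ 0 := by
      intro h
      apply ha
      field_simp at h
      simpa using h
    have hb' : z - (l : ℂ)⁻¹ = - (1 - l * z) / l := by
      field_simp
      ring
    have hd' : 1 - l * z⁻¹ = (z - l) / z := by
      field_simp
    rw [hK]
    push_cast
    rw [hb', hd']
    field_simp
    ring
  rw [Finset.sum_congr rfl hpair]
  simp only [zpow_zero, zpow_one, zpow_neg]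
  field_simp
  ring

theorem aeval_eulerPoly_exp (n : ℕ) (θ : ℝ) :
    Polynomial.aeval (Complex.exp (θ * Complex.I)) (eulerPoly (2 * n)) =
      Complex.exp (θ * Complex.I) ^ n *
        ((2 * ∑ k ∈ Finset.range n, eulerCoeff (2 * n) k * Real.cos (θ * ((n - k : ℕ) : ℝ)) +
          eulerCoeff (2 * n) n : ℝ) : ℂ) := by
  set z := Complex.exp (θ * Complex.I) with hz
  have hz0 : z ≠ 0 := Complex.exp_ne_zero _
  have hcos (j : ℕ) : (2 : ℂ) * Real.cos (θ * j) = z ^ j + (z ^ j)⁻¹ := by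
    rw [Complex.ofReal_cos, Complex.two_cos, hz, ← Complex.exp_nat_mul, ← Complex.exp_neg]
    push_cast
    congr 2 <;> ring
  have h1 : Polynomial.aeval z (eulerPoly (2 * n)) =
      ∑ s ∈ Finset.range (n + 1 + n), (eulerCoeff (2 * n) s : ℂ) * z ^ s := by
    rw [eulerPoly, show 2 * n + 1 = n + 1 + n by ring, map_sum]
    simp
  rw [h1, Finset.sum_range_add, Finset.sum_range_succ, ← Finset.sum_range_reflect (n := n)
    (fun x => (eulerCoeff (2 * n) (n + 1 + x) : ℂ) * z ^ (n + 1 + x))]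
  push_cast
  rw [mul_add, Finset.mul_sum, Finset.mul_sum, add_right_comm, ← Finset.sum_add_distrib]
  congr 1
  · refine Finset.sum_congr rfl fun k hk => ?_
    have hk' : k < n := Finset.mem_range.1 hk
    obtain ⟨j, rfl⟩ : ∃ j, n = k + j + 1 := ⟨n - k - 1, by omega⟩
    have h2 := hcos (j + 1)
    rw [show k + j + 1 + 1 + (k + j + 1 - 1 - k) = k + 2 * (j + 1) by omega,
      eulerCoeff_symm (show k + 2 * (j + 1) + k = 2 * (k + j + 1) by ring),
      show k + j + 1 - k = j + 1 by omega]
    push_cast at h2 ⊢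
    rw [mul_left_comm 2, h2]
    field_simp
    ring
  · ring

theorem one_sub_exp_pow (n : ℕ) (θ : ℝ) :
    (1 - Complex.exp ((2 * θ : ℝ) * Complex.I)) ^ (2 * n) =
      Complex.exp ((2 * θ : ℝ) * Complex.I) ^ n *
        (((-1) ^ n * 2 ^ (2 * n) * Real.sin θ ^ (2 * n) : ℝ) : ℂ) := by
  have h : (1 - Complex.exp ((2 * θ : ℝ) * Complex.I)) ^ 2 =
      Complex.exp ((2 * θ : ℝ) * Complex.I) * ((-1) * 2 ^ 2 * Complex.sin θ ^ 2) := by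
    have h1 : Complex.exp ((2 * θ : ℝ) * Complex.I) = Complex.exp (θ * Complex.I) ^ 2 := by
      rw [← Complex.exp_nat_mul]
      push_cast
      ring_nf
    have h2 := Complex.two_sin θ
    rw [neg_mul, Complex.exp_neg] at h2
    have h3 : Complex.exp (θ * Complex.I) ≠ 0 := Complex.exp_ne_zero _
    rw [h1, mul_assoc (-1 : ℂ), ← mul_pow, h2]
    field_simp
    rw [Complex.I_sq]
    ring
  rw [pow_mul, h, mul_pow, mul_pow, mul_pow, ← pow_mul, ← pow_mul]
  push_cast
  rfl

theorem Dm_fourier_transform (m : ℕ) (hm : 2 ≤ m) (h p : ℝ) (hh : 0 < h) :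
    Summable (fun β : ℤ =>
      (Dm m h β : ℂ) * Complex.exp (2 * Real.pi * Complex.I * h * p * β)) ∧
    (∑' β : ℤ, (Dm m h β : ℂ) * Complex.exp (2 * Real.pi * Complex.I * h * p * β)) *
        ((2 * ∑ k ∈ Finset.range (m - 1),
            eulerCoeff (2 * m - 2) k * Real.cos (2 * Real.pi * h * p * ((m - 1 - k : ℕ) : ℝ)) +
          eulerCoeff (2 * m - 2) (m - 1) : ℝ) : ℂ) =
      (((-1 : ℝ) ^ m * 2 ^ (2 * m) * ((2 * m - 1).factorial : ℝ) / h ^ (2 * m) *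
          Real.sin (Real.pi * h * p) ^ (2 * m) : ℝ) : ℂ) ∧
    ((2 * ∑ k ∈ Finset.range (m - 1),
          eulerCoeff (2 * m - 2) k * Real.cos (2 * Real.pi * h * p * ((m - 1 - k : ℕ) : ℝ)) +
        eulerCoeff (2 * m - 2) (m - 1) : ℝ) ≠ 0 →
      ∑' β : ℤ, (Dm m h β : ℂ) * Complex.exp (2 * Real.pi * Complex.I * h * p * β) =
        (((-1 : ℝ) ^ m * 2 ^ (2 * m) * ((2 * m - 1).factorial : ℝ) / h ^ (2 * m) *
            Real.sin (Real.pi * h * p) ^ (2 * m) /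
          (2 * ∑ k ∈ Finset.range (m - 1),
              eulerCoeff (2 * m - 2) k * Real.cos (2 * Real.pi * h * p * ((m - 1 - k : ℕ) : ℝ)) +
            eulerCoeff (2 * m - 2) (m - 1)) : ℝ) : ℂ)) := by
  obtain ⟨n, rfl⟩ : ∃ n, m = n + 1 := ⟨m - 1, by omega⟩
  set z := Complex.exp ((2 * (Real.pi * h * p) : ℝ) * Complex.I) with hz
  have hz1 : ‖z‖ = 1 := Complex.norm_exp_ofReal_mul_I _
  have hz0 : z ≠ 0 := Complex.exp_ne_zero _
  have hexp (β : ℤ) : Complex.exp (2 * Real.pi * Complex.I * h * p * β) = z ^ β := by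
    rw [hz, ← Complex.exp_int_mul]
    push_cast
    ring_nf
  obtain ⟨S, hS, hS'⟩ := hasSum_Dm (by omega : 1 ≤ n) h hz1
  simp only [hexp, Nat.add_sub_cancel, show 2 * (n + 1) - 1 = 2 * n + 1 by omega,
    show 2 * (n + 1) - 2 = 2 * n by omega, hS.tsum_eq]
  rw [show (1 - z) ^ (2 * n + 2) = (1 - z) ^ (2 * (n + 1)) by ring, hz, one_sub_exp_pow, ← hz,
    aeval_eulerPoly_exp, ← hz, show 2 * (Real.pi * h * p) = 2 * Real.pi * h * p by ring] at hS'
  set D : ℝ := 2 * ∑ k ∈ Finset.range n,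
    eulerCoeff (2 * n) k * Real.cos (2 * Real.pi * h * p * ((n - k : ℕ) : ℝ)) +
      eulerCoeff (2 * n) n with hD
  have hmul : S * (D : ℂ) = (((-1 : ℝ) ^ (n + 1) * 2 ^ (2 * (n + 1)) *
      ((2 * n + 1).factorial : ℝ) / h ^ (2 * (n + 1)) *
        Real.sin (Real.pi * h * p) ^ (2 * (n + 1)) : ℝ) : ℂ) := by
    refine mul_left_cancel₀ (pow_ne_zero (n + 1) hz0) ?_
    push_cast at hS' ⊢
    linear_combination hS'
  refine ⟨hS.summable, hmul, fun hD0 => ?_⟩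
  rw [Complex.ofReal_div, ← hmul, mul_div_cancel_right₀ _ (Complex.ofReal_ne_zero.2 hD0)]
end

section
/- Let D denote the operator taking a function g : ℝ → ℝ to the function x ↦ x·g'(x). For every integer k ≥ 0 and every real λ ≠ 1, the k-th iterate of D applied to the function x ↦ x/(1−x)^2, evaluated at λ, equals λ·E_k(λ)/(1−λ)^{k+2}; equivalently, λ·E_k(λ) = (1−λ)^{k+2}·(D^k(x/(1−x)^2))(λ). -/
/-- The operator `D = x · d/dx` acting on functions `ℝ → ℝ`. -/
noncomputable def Dop (g : ℝ → ℝ) : ℝ → ℝ := fun x => x * deriv g x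

/-- The polynomial `X * E_k`, given by its differential recurrence. -/
noncomputable def eulerNum : ℕ → Polynomial ℝ
  | 0 => Polynomial.X
  | k + 1 => Polynomial.X * ((1 - Polynomial.X) * Polynomial.derivative (eulerNum k) +
      Polynomial.C ((k : ℝ) + 2) * eulerNum k)

/-- The power series `∑ n ^ m X ^ n`. -/
noncomputable def powSeries (m : ℕ) : PowerSeries ℝ := PowerSeries.mk fun n => (n : ℝ) ^ m

theorem X_mul_derivative_powSeries (m : ℕ) :
    PowerSeries.X * PowerSeries.derivative ℝ (powSeries m) = powSeries (m + 1) := by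
  ext n
  cases n with
  | zero => simp [powSeries]
  | succ n =>
    simp [PowerSeries.coeff_succ_X_mul, powSeries, PowerSeries.coeff_derivative, pow_succ]

theorem powSeries_zero_mul_one_sub_X : powSeries 0 * (1 - PowerSeries.X) = 1 := by
  have h : powSeries 0 = PowerSeries.mk 1 := by
    ext n
    simp [powSeries]
  rw [h, PowerSeries.mk_one_mul_one_sub_eq_one]

theorem one_sub_X_pow_mul_powSeries (k : ℕ) :
    (1 - PowerSeries.X) ^ (k + 2) * powSeries (k + 1) = (eulerNum k : PowerSeries ℝ) := by
  induction k with
  | zero =>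
    have h := congrArg (PowerSeries.derivative ℝ) powSeries_zero_mul_one_sub_X
    simp only [Derivation.leibniz, map_sub, Derivation.map_one_eq_zero, smul_eq_mul,
      PowerSeries.derivative_X] at h
    rw [← X_mul_derivative_powSeries]
    simp only [eulerNum, Polynomial.coe_X]
    linear_combination (PowerSeries.X * (1 - PowerSeries.X)) * h +
      PowerSeries.X * powSeries_zero_mul_one_sub_X
  | succ k ih =>
    have h := congrArg (PowerSeries.derivative ℝ) ih
    simp only [Derivation.leibniz, Derivation.leibniz_pow, map_sub, Derivation.map_one_eq_zero,
      smul_eq_mul, nsmul_eq_mul, PowerSeries.derivative_X, PowerSeries.derivative_coe] at h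
    rw [← X_mul_derivative_powSeries]
    have hc : ((Polynomial.C ((k : ℝ) + 2) : Polynomial ℝ) : PowerSeries ℝ) =
        (k : PowerSeries ℝ) + 2 := by
      rw [Polynomial.coe_C, map_add, map_natCast, map_ofNat]
    simp only [eulerNum, Polynomial.coe_X, Polynomial.coe_mul, Polynomial.coe_add,
      Polynomial.coe_sub, Polynomial.coe_one, hc, ← ih, ← h]
    push_cast
    ring

theorem coeff_one_sub_X_pow (N j : ℕ) :
    PowerSeries.coeff j ((1 - PowerSeries.X : PowerSeries ℝ) ^ N) =
      (-1) ^ j * (N.choose j : ℝ) := by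
  have h : ((1 - PowerSeries.X : PowerSeries ℝ) ^ N) =
      (((1 + Polynomial.C (-1) * Polynomial.X) ^ N : Polynomial ℝ) : PowerSeries ℝ) := by
    simp [sub_eq_add_neg]
  have h' : ((1 + Polynomial.C (-1) * Polynomial.X) ^ N : Polynomial ℝ) =
      ((1 + Polynomial.X) ^ N : Polynomial ℝ).comp (Polynomial.C (-1) * Polynomial.X) := by
    simp
  rw [h, Polynomial.coeff_coe, h', Polynomial.comp_C_mul_X_coeff, Polynomial.coeff_one_add_X_pow]
  ring

theorem coeff_eulerNum_zero (k : ℕ) : (eulerNum k).coeff 0 = 0 := by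
  cases k <;> simp [eulerNum]

theorem coeff_eulerNum_succ (k s : ℕ) : (eulerNum k).coeff (s + 1) = eulerCoeff k s := by
  rw [← Polynomial.coeff_coe, ← one_sub_X_pow_mul_powSeries, PowerSeries.coeff_mul,
    Finset.Nat.sum_antidiagonal_eq_sum_range_succ_mk, Finset.sum_range_succ]
  simp [eulerCoeff, coeff_one_sub_X_pow, powSeries]

theorem natDegree_eulerNum_le (k : ℕ) : (eulerNum k).natDegree ≤ k + 1 := by
  induction k with
  | zero => simp [eulerNum]
  | succ k ih =>
    have hd : (Polynomial.derivative (eulerNum k)).natDegree ≤ k :=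
      (Polynomial.natDegree_derivative_le _).trans (by omega)
    have h1 : (1 - Polynomial.X : Polynomial ℝ).natDegree ≤ 1 := by compute_degree
    have h2 := Polynomial.natDegree_mul_le_of_le h1 hd
    have h3 := (Polynomial.natDegree_C_mul_le ((k : ℝ) + 2) (eulerNum k)).trans ih
    have h4 := Polynomial.natDegree_add_le_of_degree_le (h2.trans (by omega)) h3
    have h5 := Polynomial.natDegree_mul_le_of_le (Polynomial.natDegree_X_le (R := ℝ)) h4
    rw [eulerNum]
    exact h5.trans (by omega)

theorem eval_eulerNum (k : ℕ) (x : ℝ) : (eulerNum k).eval x = x * (eulerPoly k).eval x := by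
  rw [Polynomial.eval_eq_sum_range' (Nat.lt_succ_of_le (natDegree_eulerNum_le k)),
    Finset.sum_range_succ', coeff_eulerNum_zero, eulerPoly, Polynomial.eval_finsetSum,
    Finset.mul_sum]
  simp only [zero_mul, add_zero, coeff_eulerNum_succ, Polynomial.eval_mul, Polynomial.eval_C,
    Polynomial.eval_pow, Polynomial.eval_X]
  exact Finset.sum_congr rfl fun s _ => by ring

theorem iterate_Dop_eq (k : ℕ) (x : ℝ) (hx : x ≠ 1) :
    (Dop^[k] (fun x : ℝ => x / (1 - x) ^ 2)) x = (eulerNum k).eval x / (1 - x) ^ (k + 2) := by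
  induction k generalizing x with
  | zero => simp [eulerNum]
  | succ k ih =>
    have hx' : 1 - x ≠ 0 := sub_ne_zero.mpr hx.symm
    have he : Dop^[k] (fun x : ℝ => x / (1 - x) ^ 2) =ᶠ[nhds x]
        fun y => (eulerNum k).eval y / (1 - y) ^ (k + 2) := by
      filter_upwards [isOpen_ne.mem_nhds hx] with y hy using ih y hy
    have hd := ((eulerNum k).hasDerivAt x).div
      (((hasDerivAt_id x).const_sub 1).pow (k + 2)) (pow_ne_zero _ hx')
    have hd' : deriv (fun y => (eulerNum k).eval y / (1 - y) ^ (k + 2)) x = _ := hd.deriv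
    rw [Function.iterate_succ_apply', Dop, he.deriv_eq, hd']
    simp only [eulerNum, Polynomial.eval_mul, Polynomial.eval_add, Polynomial.eval_sub,
      Polynomial.eval_X, Polynomial.eval_one, Polynomial.eval_C, id, Pi.pow_apply]
    simp only [show k + 2 - 1 = k + 1 from rfl]
    push_cast
    field_simp
    ring

theorem euler_poly_Dop (k : ℕ) (l : ℝ) (hl : l ≠ 1) :
    l * (eulerPoly k).eval l =
      (1 - l) ^ (k + 2) * (Dop^[k] (fun x : ℝ => x / (1 - x) ^ 2)) l := by
  rw [iterate_Dop_eq k l hl, mul_div_cancel₀ _ (pow_ne_zero _ (sub_ne_zero.mpr hl.symm)),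
    eval_eulerNum]
end

section
/- Let m ≥ 1 be an integer and let q ∈ ℝ \ ℤ. Put λ = exp(2πi·q) ∈ ℂ. Then the series ∑_{n∈ℤ} 1/(q−n)^{2m} converges absolutely and (as an identity in ℂ) ∑_{n∈ℤ} 1/(q−n)^{2m} = (−1)^m · ((2π)^{2m}/(2m−1)!) · λ·E_{2m-2}(λ)/(1−λ)^{2m}, where E_{2m-2} is evaluated at the complex number λ. -/
/-- The Euler–Frobenius coefficient `a_s^{(k)}` as a complex number. -/
noncomputable def eulerCoeffC (k s : ℕ) : ℂ :=
  ∑ j ∈ Finset.range (s + 1),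
    (-1 : ℂ) ^ j * (Nat.choose (k + 2) j : ℂ) * ((s + 1 - j : ℕ) : ℂ) ^ (k + 1)

/-- The Euler–Frobenius polynomial `E_k` over `ℂ`. -/
noncomputable def eulerPolyC (k : ℕ) : Polynomial ℂ :=
  ∑ s ∈ Finset.range (k + 1), Polynomial.C (eulerCoeffC k s) * Polynomial.X ^ s

section

open Finset Filter Topology

/-- The `(k + 1)`-st backward difference of `x ↦ x ^ k` vanishes. -/
theorem sum_alternating_choose_mul_sub_pow_eq_zero {k N : ℕ} (hN : k + 1 ≤ N) :
    ∑ j ∈ range (N + 1), (-1 : ℂ) ^ j * ((k + 1).choose j : ℂ) * ((N - j : ℕ) : ℂ) ^ k = 0 := by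
  have hsub : ∑ j ∈ range (N + 1), (-1 : ℂ) ^ j * ((k + 1).choose j : ℂ) * ((N - j : ℕ) : ℂ) ^ k =
      ∑ j ∈ range (k + 1 + 1),
        (-1 : ℂ) ^ j * ((k + 1).choose j : ℂ) * ((N - j : ℕ) : ℂ) ^ k := by
    refine (sum_subset (range_mono (by lia)) fun j _ hj => ?_).symm
    rw [Nat.choose_eq_zero_of_lt (by simpa using hj)]
    simp
  have hdiff : (fwdDiff 1)^[k + 1] (fun x : ℂ => x ^ k) ((N - (k + 1) : ℕ) : ℂ) = 0 := by
    rw [fwdDiff_iter_pow_eq_zero_of_lt (Nat.lt_succ_self k), Pi.zero_apply]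
  rw [fwdDiff_iter_eq_sum_shift, ← sum_range_reflect] at hdiff
  rw [hsub, ← hdiff]
  refine sum_congr rfl fun j hj => ?_
  have hj' : j ≤ k + 1 := by simpa [Nat.lt_succ_iff] using hj
  have hreflect : k + 1 + 1 - 1 - j = k + 1 - j := by lia
  have hshift : N - j = N - (k + 1) + (k + 1 - j) := by lia
  have hcancel : k + 1 - (k + 1 - j) = j := by lia
  rw [hreflect, hshift, hcancel, Nat.choose_symm hj']
  simp

theorem one_sub_pow_eq_tsum (K : ℕ) (r : ℂ) :
    (1 - r) ^ K = ∑' j : ℕ, (-1 : ℂ) ^ j * (K.choose j : ℂ) * r ^ j := by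
  rw [tsum_eq_sum (s := range (K + 1)) fun j hj => by
    rw [Nat.choose_eq_zero_of_lt (by simpa using hj)]; simp]
  rw [sub_eq_neg_add, add_pow]
  refine sum_congr rfl fun j _ => ?_
  rw [neg_pow r]
  ring

/-- The generating function of the powers `n ^ (p + 1)` in terms of the Euler–Frobenius polynomial. -/
theorem tsum_pow_mul_geometric_mul_one_sub_pow (p : ℕ) {r : ℂ} (hr : ‖r‖ < 1) :
    (∑' n : ℕ, (n : ℂ) ^ (p + 1) * r ^ n) * (1 - r) ^ (p + 2) = r * (eulerPolyC p).eval r := by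
  have hfin : Summable fun j : ℕ => ‖(-1 : ℂ) ^ j * ((p + 2).choose j : ℂ) * r ^ j‖ :=
    summable_of_ne_finset_zero (s := range (p + 2 + 1)) fun j hj => by
      rw [Nat.choose_eq_zero_of_lt (by simpa using hj)]; simp
  have hcoeff (N : ℕ) : ∑ j ∈ range (N + 1), (-1 : ℂ) ^ j * ((p + 2).choose j : ℂ) * r ^ j *
      (((N - j : ℕ) : ℂ) ^ (p + 1) * r ^ (N - j)) =
      (∑ j ∈ range (N + 1), (-1 : ℂ) ^ j * ((p + 2).choose j : ℂ) *
        ((N - j : ℕ) : ℂ) ^ (p + 1)) * r ^ N := by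
    rw [sum_mul]
    refine sum_congr rfl fun j hj => ?_
    have hj' : j ≤ N := Nat.lt_succ_iff.mp (mem_range.mp hj)
    rw [← pow_mul_pow_sub r hj']
    ring
  rw [mul_comm, one_sub_pow_eq_tsum, tsum_mul_tsum_eq_tsum_sum_range_of_summable_norm hfin
    (summable_norm_pow_mul_geometric_of_norm_lt_one (p + 1) hr)]
  simp_rw [hcoeff]
  rw [tsum_eq_sum (s := range (p + 2)) fun N hN => by
    rw [sum_alternating_choose_mul_sub_pow_eq_zero (k := p + 1) (not_lt.mp (mt mem_range.mpr hN)), zero_mul]]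
  rw [sum_range_succ', eulerPolyC, Polynomial.eval_finsetSum, mul_sum]
  simp only [zero_add, range_one, sum_singleton, Nat.sub_self, Nat.cast_zero, ne_eq,
    Nat.add_eq_zero_iff, one_ne_zero, and_false, not_false_eq_true, zero_pow, mul_zero, zero_mul,
    add_zero]
  refine sum_congr rfl fun s _ => ?_
  rw [sum_range_succ, Nat.sub_self, Nat.cast_zero, zero_pow (Nat.succ_ne_zero p), mul_zero,
    add_zero, Polynomial.eval_mul, Polynomial.eval_C, Polynomial.eval_pow, Polynomial.eval_X,
    eulerCoeffC]
  ring

theorem UpperHalfPlane.tsum_one_div_add_pow_eq_eulerPolyC (p : ℕ) (z : UpperHalfPlane) :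
    ∑' n : ℤ, 1 / ((z : ℂ) + n) ^ (p + 2) =
      (-2 * Real.pi * Complex.I) ^ (p + 2) / ((p + 1).factorial : ℂ) *
        (Complex.exp (2 * Real.pi * Complex.I * z) *
          (eulerPolyC p).eval (Complex.exp (2 * Real.pi * Complex.I * z)) /
            (1 - Complex.exp (2 * Real.pi * Complex.I * z)) ^ (p + 2)) := by
  have hr := UpperHalfPlane.norm_exp_two_pi_I_lt_one z
  have hne : 1 - Complex.exp (2 * Real.pi * Complex.I * z) ≠ 0 := fun h => by
    rw [← sub_eq_zero.mp h] at hr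
    simp at hr
  rw [EisensteinSeries.qExpansion_identity (Nat.le_add_left 1 p) z,
    ← tsum_pow_mul_geometric_mul_one_sub_pow p hr, mul_div_cancel_right₀ _ (pow_ne_zero _ hne)]

theorem Real.summable_one_div_int_add_pow (a : ℝ) {k : ℕ} (hk : 2 ≤ k) :
    Summable fun n : ℤ => 1 / |n + a| ^ k := by
  simpa using (Real.summable_one_div_int_add_rpow a k).mpr (by exact_mod_cast hk)

theorem Complex.tendsto_tsum_one_div_add_pow (x : ℝ) (hx : ∀ n : ℤ, x ≠ n) {k : ℕ} (hk : 2 ≤ k) :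
    Tendsto (fun t : ℝ => ∑' n : ℤ, 1 / ((x + t * Complex.I : ℂ) + n) ^ k) (𝓝[>] 0)
      (𝓝 (∑' n : ℤ, 1 / ((x : ℂ) + n) ^ k)) := by
  have hne (n : ℤ) : (n : ℝ) + x ≠ 0 := fun h => hx (-n) (by push_cast; linarith)
  refine tendsto_tsum_of_dominated_convergence (Real.summable_one_div_int_add_pow x hk)
    (fun n => ?_) (Eventually.of_forall fun t n => ?_)
  · have hcont : ContinuousAt (fun t : ℝ => 1 / ((x + t * Complex.I : ℂ) + n) ^ k) 0 := by
      refine continuousAt_const.div (by fun_prop) (pow_ne_zero _ ?_)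
      have := hne n
      rw [add_comm] at this
      simpa using (by exact_mod_cast this : (x : ℂ) + n ≠ 0)
    simpa using hcont.tendsto.mono_left nhdsWithin_le_nhds
  · rw [norm_div, norm_one, norm_pow]
    have hpos : 0 < |(n : ℝ) + x| := abs_pos.mpr (hne n)
    gcongr
    simpa [add_comm] using Complex.abs_re_le_norm ((x + t * Complex.I : ℂ) + n)

theorem Complex.exp_two_pi_mul_I_mul_ofReal_ne_one {x : ℝ} (hx : ∀ n : ℤ, x ≠ n) :
    Complex.exp (2 * Real.pi * Complex.I * x) ≠ 1 := by
  rw [Ne, Complex.exp_eq_one_iff]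
  rintro ⟨n, hn⟩
  refine hx n ?_
  rw [mul_comm] at hn
  exact_mod_cast mul_right_cancel₀ Complex.two_pi_I_ne_zero hn

theorem Complex.tsum_one_div_add_pow_eq_eulerPolyC (p : ℕ) {x : ℝ} (hx : ∀ n : ℤ, x ≠ n) :
    ∑' n : ℤ, 1 / ((x : ℂ) + n) ^ (p + 2) =
      (-2 * Real.pi * Complex.I) ^ (p + 2) / ((p + 1).factorial : ℂ) *
        (Complex.exp (2 * Real.pi * Complex.I * x) *
          (eulerPolyC p).eval (Complex.exp (2 * Real.pi * Complex.I * x)) /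
            (1 - Complex.exp (2 * Real.pi * Complex.I * x)) ^ (p + 2)) := by
  have hcont : ContinuousAt (fun t : ℝ =>
      (-2 * Real.pi * Complex.I) ^ (p + 2) / ((p + 1).factorial : ℂ) *
        (Complex.exp (2 * Real.pi * Complex.I * (x + t * Complex.I)) *
          (eulerPolyC p).eval (Complex.exp (2 * Real.pi * Complex.I * (x + t * Complex.I))) /
            (1 - Complex.exp (2 * Real.pi * Complex.I * (x + t * Complex.I))) ^ (p + 2))) 0 := by
    refine continuousAt_const.mul (ContinuousAt.div ?_ (by fun_prop) (pow_ne_zero _ ?_))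
    · exact (Continuous.mul (by fun_prop)
        ((eulerPolyC p).continuous.comp (by fun_prop))).continuousAt
    · simpa [sub_eq_zero] using (exp_two_pi_mul_I_mul_ofReal_ne_one hx).symm
  have hlim := hcont.tendsto.mono_left (nhdsWithin_le_nhds (s := Set.Ioi 0))
  simp only [Complex.ofReal_zero, zero_mul, add_zero] at hlim
  refine tendsto_nhds_unique (tendsto_tsum_one_div_add_pow x hx (Nat.le_add_left 2 p))
    (hlim.congr' ?_)
  filter_upwards [self_mem_nhdsWithin] with t ht
  exact (UpperHalfPlane.tsum_one_div_add_pow_eq_eulerPolyC p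
    ⟨x + t * Complex.I, by simpa using ht⟩).symm

end

theorem sum_inv_pow_eq_euler (m : ℕ) (hm : 1 ≤ m) (q : ℝ) (hq : ∀ n : ℤ, q ≠ n) :
    Summable (fun n : ℤ => 1 / (q - (n : ℝ)) ^ (2 * m)) ∧
    ((∑' n : ℤ, 1 / (q - (n : ℝ)) ^ (2 * m) : ℝ) : ℂ) =
      (-1 : ℂ) ^ m * ((2 * Real.pi) ^ (2 * m) / ((2 * m - 1).factorial : ℂ)) *
        Complex.exp (2 * Real.pi * Complex.I * q) *
          (eulerPolyC (2 * m - 2)).eval (Complex.exp (2 * Real.pi * Complex.I * q)) /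
            (1 - Complex.exp (2 * Real.pi * Complex.I * q)) ^ (2 * m) := by
  have hneg (k : ℕ) : (fun n : ℤ => 1 / (q - (n : ℝ)) ^ k) =
      (fun n : ℤ => 1 / ((n : ℝ) + q) ^ k) ∘ Equiv.neg ℤ := by
    ext n
    simp [sub_eq_neg_add]
  obtain ⟨l, rfl⟩ := Nat.exists_eq_add_of_le' hm
  refine ⟨?_, ?_⟩
  · rw [hneg, Equiv.summable_iff]
    simpa [(even_two_mul (l + 1)).pow_abs] using
      Real.summable_one_div_int_add_pow q (k := 2 * (l + 1)) (by lia)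
  · have hcast : ((∑' n : ℤ, 1 / (q - (n : ℝ)) ^ (2 * (l + 1)) : ℝ) : ℂ) =
        ∑' n : ℤ, 1 / ((q : ℂ) + n) ^ (2 * l + 2) := by
      rw [hneg, ← (Equiv.neg ℤ).tsum_eq, Complex.ofReal_tsum]
      simp [add_comm, mul_add]
    have hconst : (-2 * Real.pi * Complex.I) ^ (2 * l + 2) =
        (-1) ^ (l + 1) * (2 * Real.pi : ℂ) ^ (2 * (l + 1)) := by
      rw [show 2 * l + 2 = 2 * (l + 1) by ring, pow_mul, pow_mul (2 * Real.pi : ℂ), ← mul_pow]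
      congr 1
      linear_combination 4 * (Real.pi : ℂ) ^ 2 * Complex.I_sq
    rw [hcast, Complex.tsum_one_div_add_pow_eq_eulerPolyC _ hq, hconst,
      show 2 * (l + 1) - 1 = 2 * l + 1 by lia, show 2 * (l + 1) - 2 = 2 * l by lia,
      show 2 * (l + 1) = 2 * l + 2 by ring]
    ring
end

section
/- Let m ≥ 1 be an integer and let q ∈ ℝ \ ℤ. Then the (2m−2)-nd iterated derivative of the function x ↦ 1/sin^2(πx) at q equals ((2m−1)!/π^2)·∑_{n∈ℤ} 1/(q−n)^{2m}, the series converging absolutely. -/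
lemma exists_ball_half_abs_sub_intCast_le {q : ℝ} (hq : ∀ n : ℤ, q ≠ n) :
    ∃ r > 0, ∀ y ∈ Metric.ball q r, ∀ n : ℤ, |q - n| / 2 ≤ |y - n| := by
  have hpos : 0 < Metric.infDist q (Set.range ((↑) : ℤ → ℝ)) := by
    refine (Real.isClosed_range_intCast.notMem_iff_infDist_pos (Set.range_nonempty _)).1 ?_
    rintro ⟨n, hn⟩
    exact hq n hn.symm
  refine ⟨_, half_pos hpos, fun y hy n => ?_⟩
  have h1 : Metric.infDist q (Set.range ((↑) : ℤ → ℝ)) ≤ |q - n| :=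
    Metric.infDist_le_dist_of_mem (Set.mem_range_self n)
  rw [Metric.mem_ball, dist_comm, Real.dist_eq] at hy
  linarith [abs_sub_le q y n]

lemma norm_neg_div_sub_intCast_pow_le {q y : ℝ} (hq : ∀ n : ℤ, q ≠ n) (n : ℤ)
    (h : |q - n| / 2 ≤ |y - n|) (k : ℕ) (c : ℝ) :
    ‖-c / (y - n) ^ k‖ ≤ |c| * 2 ^ k * |1 / (q - n) ^ k| := by
  have hpos : 0 < |q - n| := abs_pos.2 (sub_ne_zero.2 (hq n))
  calc ‖-c / (y - n) ^ k‖ = |c| / |y - n| ^ k := by simp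
    _ ≤ |c| / (|q - n| / 2) ^ k := by gcongr
    _ = |c| * 2 ^ k * |1 / (q - n) ^ k| := by
      rw [abs_div, abs_pow, abs_one, div_pow]
      field_simp

lemma summable_one_div_sub_intCast_pow (q : ℝ) {k : ℕ} (hk : 2 ≤ k) :
    Summable fun n : ℤ => 1 / (q - n) ^ k := by
  have h := (Real.summable_one_div_int_add_rpow (-q) k).2 (by exact_mod_cast hk)
  refine Summable.of_norm (h.congr fun n => ?_)
  rw [Real.rpow_natCast, norm_div, norm_pow, norm_one, Real.norm_eq_abs, abs_sub_comm,
    sub_eq_add_neg]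

lemma hasDerivAt_one_div_sub_pow {x a : ℝ} (h : x ≠ a) (k : ℕ) :
    HasDerivAt (fun x : ℝ => 1 / (x - a) ^ k) (-(k : ℝ) / (x - a) ^ (k + 1)) x := by
  have h0 : x - a ≠ 0 := sub_ne_zero.2 h
  have h1 := (((hasDerivAt_id x).sub_const a).fun_pow k).fun_inv (pow_ne_zero k h0)
  simp only [one_div]
  refine h1.congr_deriv ?_
  rcases k with _ | k
  · simp
  · simp only [id, Nat.add_sub_cancel]
    field_simp
    ring

lemma hasDerivAt_tsum_one_div_sub_intCast_pow {q : ℝ} (hq : ∀ n : ℤ, q ≠ n) {k : ℕ}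
    (hk : 2 ≤ k) :
    HasDerivAt (fun x : ℝ => ∑' n : ℤ, 1 / (x - n) ^ k)
      (-(k : ℝ) * ∑' n : ℤ, 1 / (q - n) ^ (k + 1)) q := by
  obtain ⟨r, hr, hball⟩ := exists_ball_half_abs_sub_intCast_le hq
  have hu : Summable fun n : ℤ => |(k : ℝ)| * 2 ^ (k + 1) * |1 / (q - n) ^ (k + 1)| :=
    (summable_one_div_sub_intCast_pow q (by lia)).abs.mul_left _
  have h := hasDerivAt_tsum_of_isPreconnected hu Metric.isOpen_ball
    (convex_ball q r).isPreconnected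
    (g := fun (n : ℤ) (x : ℝ) => 1 / (x - n) ^ k)
    (g' := fun (n : ℤ) (x : ℝ) => -(k : ℝ) / (x - n) ^ (k + 1))
    (fun n y hy => hasDerivAt_one_div_sub_pow (fun hyn => by
      have := hball y hy n
      have := abs_pos.2 (sub_ne_zero.2 (hq n))
      simp only [hyn, sub_self, abs_zero] at *
      linarith) k)
    (fun n y hy => norm_neg_div_sub_intCast_pow_le hq n (hball y hy n) (k + 1) k)
    (Metric.mem_ball_self hr) (summable_one_div_sub_intCast_pow q hk) (Metric.mem_ball_self hr)
  rw [← tsum_mul_left]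
  simpa only [mul_one_div] using h

lemma ofReal_mem_integerComplement {q : ℝ} (hq : ∀ n : ℤ, q ≠ n) :
    (q : ℂ) ∈ Complex.integerComplement := by
  rintro ⟨n, hn⟩
  exact hq n (by exact_mod_cast hn.symm)

lemma eventually_ne_intCast {q : ℝ} (hq : ∀ n : ℤ, q ≠ n) :
    ∀ᶠ x : ℝ in nhds q, ∀ n : ℤ, x ≠ n := by
  have := Real.isOpen_compl_range_intCast.mem_nhds (x := q) (by
    rintro ⟨n, hn⟩
    exact hq n hn.symm)
  filter_upwards [this] with x hx n hn
  exact hx ⟨n, hn.symm⟩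

lemma summable_real_cotTerm {q : ℝ} (hq : ∀ n : ℤ, q ≠ n) :
    Summable fun n : ℕ => 1 / (q - (n + 1)) + 1 / (q + (n + 1)) := by
  have h := summable_cotTerm (ofReal_mem_integerComplement hq)
  simp only [cotTerm] at h
  exact_mod_cast h

lemma real_cot_series_rep {q : ℝ} (hq : ∀ n : ℤ, q ≠ n) :
    Real.pi * Real.cot (Real.pi * q) =
      1 / q + ∑' n : ℕ, (1 / (q - (n + 1)) + 1 / (q + (n + 1))) := by
  have h := cot_series_rep' (ofReal_mem_integerComplement hq)
  have h' : Real.pi * Real.cot (Real.pi * q) - 1 / q =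
      ∑' n : ℕ, (1 / (q - (n + 1)) + 1 / (q + (n + 1))) := by exact_mod_cast h
  linarith

lemma sin_pi_mul_ne_zero_of_ne_intCast {q : ℝ} (hq : ∀ n : ℤ, q ≠ n) :
    Real.sin (Real.pi * q) ≠ 0 := by
  rw [Real.sin_ne_zero_iff]
  intro n hn
  rw [mul_comm] at hn
  exact hq n (mul_left_cancel₀ Real.pi_ne_zero hn).symm

lemma hasDerivAt_pi_mul_cot {q : ℝ} (hq : ∀ n : ℤ, q ≠ n) :
    HasDerivAt (fun x : ℝ => Real.pi * Real.cot (Real.pi * x))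
      (-Real.pi ^ 2 / Real.sin (Real.pi * q) ^ 2) q := by
  have hs := sin_pi_mul_ne_zero_of_ne_intCast hq
  have hl : HasDerivAt (fun x : ℝ => Real.pi * x) Real.pi q := by
    simpa using (hasDerivAt_id q).const_mul Real.pi
  have h := (hl.cos.fun_div hl.sin hs).const_mul Real.pi
  simp only [Real.cot_eq_cos_div_sin]
  refine h.congr_deriv ?_
  field_simp
  linear_combination -Real.sin_sq_add_cos_sq (Real.pi * q)

lemma hasDerivAt_tsum_cotTerm {q : ℝ} (hq : ∀ n : ℤ, q ≠ n) :
    HasDerivAt (fun x : ℝ => ∑' n : ℕ, (1 / (x - (n + 1)) + 1 / (x + (n + 1))))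
      (∑' n : ℕ, (-1 / (q - (n + 1)) ^ 2 + -1 / (q + (n + 1)) ^ 2)) q := by
  obtain ⟨r, hr, hball⟩ := exists_ball_half_abs_sub_intCast_le hq
  have hsum := (summable_one_div_sub_intCast_pow q le_rfl).abs.mul_left (|(1 : ℝ)| * 2 ^ 2)
  have hpos : Function.Injective fun n : ℕ => (n + 1 : ℤ) := fun a b h => by simpa using h
  have hneg : Function.Injective fun n : ℕ => -(n + 1 : ℤ) := fun a b h => by simpa using h
  have hne : ∀ y ∈ Metric.ball q r, ∀ n : ℤ, y ≠ n := fun y hy n hyn => by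
    have := hball y hy n
    have := abs_pos.2 (sub_ne_zero.2 (hq n))
    simp only [hyn, sub_self, abs_zero] at *
    linarith
  refine hasDerivAt_tsum_of_isPreconnected
    ((hsum.comp_injective hpos).add (hsum.comp_injective hneg)) Metric.isOpen_ball
    (convex_ball q r).isPreconnected
    (g := fun (n : ℕ) (x : ℝ) => 1 / (x - (n + 1)) + 1 / (x + (n + 1)))
    (g' := fun (n : ℕ) (x : ℝ) => -1 / (x - (n + 1)) ^ 2 + -1 / (x + (n + 1)) ^ 2)
    (fun n y hy => ?_) (fun n y hy => ?_)
    (Metric.mem_ball_self hr) (summable_real_cotTerm hq) (Metric.mem_ball_self hr)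
  · have h := (hasDerivAt_one_div_sub_pow (hne y hy (n + 1)) 1).add
      (hasDerivAt_one_div_sub_pow (hne y hy (-(n + 1))) 1)
    simpa [Pi.add_def, -neg_add_rev] using h
  · refine (norm_add_le _ _).trans (add_le_add ?_ ?_)
    · simpa using norm_neg_div_sub_intCast_pow_le hq (n + 1) (hball y hy _) 2 1
    · simpa [-neg_add_rev] using norm_neg_div_sub_intCast_pow_le hq (-(n + 1)) (hball y hy _) 2 1

lemma one_div_sin_sq_eq_tsum {q : ℝ} (hq : ∀ n : ℤ, q ≠ n) :
    1 / Real.sin (Real.pi * q) ^ 2 = 1 / Real.pi ^ 2 * ∑' n : ℤ, 1 / (q - n) ^ 2 := by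
  have hs := summable_one_div_sub_intCast_pow q le_rfl
  have hpos : Summable fun n : ℕ => 1 / (q - (n + 1)) ^ 2 := by
    simpa [Function.comp_def] using
      hs.comp_injective (i := fun n : ℕ => (n + 1 : ℤ)) fun a b h => by simpa using h
  have hneg : Summable fun n : ℕ => 1 / (q + (n + 1)) ^ 2 := by
    simpa [Function.comp_def, -neg_add_rev] using
      hs.comp_injective (i := fun n : ℕ => -(n + 1 : ℤ)) fun a b h => by simpa using h
  have hrec : (fun x : ℝ => Real.pi * Real.cot (Real.pi * x)) =ᶠ[nhds q]
      fun x => 1 / (x - 0) ^ 1 + ∑' n : ℕ, (1 / (x - (n + 1)) + 1 / (x + (n + 1))) := by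
    filter_upwards [eventually_ne_intCast hq] with x hx
    simpa using real_cot_series_rep hx
  have hq0 : q ≠ 0 := by simpa using hq 0
  have hd := (hasDerivAt_pi_mul_cot hq).unique
    (((hasDerivAt_one_div_sub_pow hq0 1).add (hasDerivAt_tsum_cotTerm hq)).congr_of_eventuallyEq
      hrec)
  have hint : ∑' n : ℤ, 1 / (q - n) ^ 2 = ∑' n : ℕ, 1 / (q - (n + 1)) ^ 2 + 1 / q ^ 2 +
      ∑' n : ℕ, 1 / (q + (n + 1)) ^ 2 := by
    rw [tsum_of_add_one_of_neg_add_one (f := fun n : ℤ => 1 / (q - n) ^ 2)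
      (by simpa using hpos) (by simpa [-neg_add_rev] using hneg)]
    simp [-neg_add_rev]
  have hnat : ∑' n : ℕ, (-1 / (q - (n + 1)) ^ 2 + -1 / (q + (n + 1)) ^ 2) =
      -(∑' n : ℕ, 1 / (q - (n + 1)) ^ 2 + ∑' n : ℕ, 1 / (q + (n + 1)) ^ 2) := by
    rw [← hpos.tsum_add hneg, ← tsum_neg]
    congr 1
    ext n
    ring
  have hsin := sin_pi_mul_ne_zero_of_ne_intCast hq
  have hpi := Real.pi_ne_zero
  rw [hnat] at hd
  have hkey : Real.pi ^ 2 / Real.sin (Real.pi * q) ^ 2 = ∑' n : ℤ, 1 / (q - n) ^ 2 := by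
    rw [hint]
    simp only [sub_zero, Nat.cast_one, one_add_one_eq_two] at hd
    linear_combination -hd
  rw [← hkey]
  field_simp

lemma iterate_deriv_one_div_sin_sq (j : ℕ) {q : ℝ} (hq : ∀ n : ℤ, q ≠ n) :
    deriv^[j] (fun x : ℝ => 1 / Real.sin (Real.pi * x) ^ 2) q =
      (-1) ^ j * ((j + 1).factorial / Real.pi ^ 2) * ∑' n : ℤ, 1 / (q - n) ^ (j + 2) := by
  induction j generalizing q with
  | zero => simpa using one_div_sin_sq_eq_tsum hq
  | succ j ih =>
    rw [Function.iterate_succ_apply']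
    have he : deriv^[j] (fun x : ℝ => 1 / Real.sin (Real.pi * x) ^ 2) =ᶠ[nhds q] fun x =>
        (-1) ^ j * ((j + 1).factorial / Real.pi ^ 2) * ∑' n : ℤ, 1 / (x - n) ^ (j + 2) := by
      filter_upwards [eventually_ne_intCast hq] with x hx using ih hx
    rw [he.deriv_eq,
      ((hasDerivAt_tsum_one_div_sub_intCast_pow hq (by lia : 2 ≤ j + 2)).const_mul _).deriv,
      Nat.factorial_succ (j + 1), show j + 1 + 2 = j + 2 + 1 by ring]
    push_cast
    ring

theorem iteratedDeriv_inv_sin_sq (m : ℕ) (hm : 1 ≤ m) (q : ℝ) (hq : ∀ n : ℤ, q ≠ n) :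
    Summable (fun n : ℤ => 1 / (q - (n : ℝ)) ^ (2 * m)) ∧
    deriv^[2 * m - 2] (fun x : ℝ => 1 / Real.sin (Real.pi * x) ^ 2) q =
      (((2 * m - 1).factorial : ℝ) / Real.pi ^ 2) *
        ∑' n : ℤ, 1 / (q - (n : ℝ)) ^ (2 * m) := by
  refine ⟨summable_one_div_sub_intCast_pow q (by lia), ?_⟩
  rw [iterate_deriv_one_div_sin_sq _ hq, Even.neg_one_pow ⟨m - 1, by lia⟩, one_mul,
    show 2 * m - 2 + 1 = 2 * m - 1 by lia, show 2 * m - 2 + 2 = 2 * m by lia]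
end

section
/- Let m ≥ 2 be an integer and work over ℂ. For every λ ∈ ℂ with λ ≠ 0 and E_{2m-2}(λ) ≠ 0, one has the partial-fraction expansion (1−λ)^{2m}/(λ·E_{2m-2}(λ)) = λ − 2m − a_{2m-3}^{(2m-2)} + 1/λ + ∑_{μ} (1−μ)^{2m} / (μ·E_{2m-2}'(μ)·(λ−μ)), where the sum is over the complex roots μ of E_{2m-2} (counted once each; all roots of E_{2m-2} are simple). -/
open Polynomial

theorem eulerCoeffC_zero (k : ℕ) : eulerCoeffC k 0 = 1 := by
  simp [eulerCoeffC]

theorem eulerCoeffC_succ_succ (k s : ℕ) :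
    eulerCoeffC (k + 1) (s + 1) =
      (s + 2) * eulerCoeffC k (s + 1) + (k + 1 - s) * eulerCoeffC k s := by
  unfold eulerCoeffC
  rw [Finset.sum_range_succ' _ (s + 1), Finset.sum_range_succ' _ (s + 1), mul_add,
    Finset.mul_sum, Finset.mul_sum, add_right_comm (Finset.sum _ _), ← Finset.sum_add_distrib]
  congr 1
  · refine Finset.sum_congr rfl fun j hj => ?_
    have hjs : j ≤ s := Nat.lt_succ_iff.mp (Finset.mem_range.mp hj)
    have h1 : ((k + 2).choose j + (k + 2).choose (j + 1) : ℂ) = (k + 3).choose (j + 1) := by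
      rw [Nat.choose_succ_succ (k + 2) j]; push_cast; rfl
    have h2 : ((k + 3) * (k + 2).choose j : ℂ) = (k + 3).choose (j + 1) * (j + 1) := by
      exact_mod_cast Nat.add_one_mul_choose_eq (k + 2) j
    rw [show s + 1 + 1 - (j + 1) = s + 1 - j by omega, Nat.cast_sub (by omega)]
    push_cast
    rw [← h1] at h2 ⊢
    rw [pow_succ _ (k + 1)]
    linear_combination -(-1) ^ j * ((s : ℂ) + 1 - j) ^ (k + 1) * h2
  · simp
    ring

theorem eulerCoeffC_zero_succ (s : ℕ) : eulerCoeffC 0 (s + 1) = 0 := by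
  rcases s with _ | s
  · norm_num [eulerCoeffC, Finset.sum_range_succ]
  · rw [eulerCoeffC, Finset.sum_range_succ', Finset.sum_range_succ', Finset.sum_range_succ',
      Finset.sum_eq_zero]
    · norm_num
      ring
    · intro j _
      rw [Nat.choose_eq_zero_of_lt (by omega)]
      simp

theorem eulerCoeffC_eq_zero_of_lt {k s : ℕ} (h : k < s) : eulerCoeffC k s = 0 := by
  induction k generalizing s with
  | zero =>
    obtain ⟨s, rfl⟩ := Nat.exists_eq_add_one_of_ne_zero h.ne'
    exact eulerCoeffC_zero_succ s
  | succ k ih =>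
    obtain ⟨s, rfl⟩ := Nat.exists_eq_add_one_of_ne_zero (Nat.ne_zero_of_lt h)
    rw [eulerCoeffC_succ_succ, ih (by omega), ih (by omega)]
    simp

theorem eulerCoeffC_self (k : ℕ) : eulerCoeffC k k = 1 := by
  induction k with
  | zero => exact eulerCoeffC_zero 0
  | succ k ih => simp [eulerCoeffC_succ_succ, eulerCoeffC_eq_zero_of_lt, ih]

theorem coeff_eulerPolyC (k s : ℕ) : (eulerPolyC k).coeff s = eulerCoeffC k s := by
  simp only [eulerPolyC, finsetSum_coeff, coeff_C_mul_X_pow, Finset.sum_ite_eq, Finset.mem_range]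
  split_ifs with h
  · rfl
  · exact (eulerCoeffC_eq_zero_of_lt (by omega)).symm

theorem natDegree_eulerPolyC (k : ℕ) : (eulerPolyC k).natDegree = k := by
  refine natDegree_eq_of_le_of_coeff_ne_zero ?_ ?_
  · refine natDegree_le_iff_coeff_eq_zero.mpr fun s hs => ?_
    rw [coeff_eulerPolyC, eulerCoeffC_eq_zero_of_lt hs]
  · rw [coeff_eulerPolyC, eulerCoeffC_self]
    exact one_ne_zero

theorem monic_eulerPolyC (k : ℕ) : (eulerPolyC k).Monic := by
  rw [Monic, leadingCoeff, natDegree_eulerPolyC, coeff_eulerPolyC, eulerCoeffC_self]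

theorem eulerPolyC_zero : eulerPolyC 0 = 1 := by
  simp [eulerPolyC, eulerCoeffC_zero]

theorem eulerPolyC_succ (k : ℕ) :
    eulerPolyC (k + 1) =
      (1 + ((k : ℂ[X]) + 1) * X) * eulerPolyC k + X * (1 - X) * derivative (eulerPolyC k) := by
  have h : (1 + ((k : ℂ[X]) + 1) * X) * eulerPolyC k + X * (1 - X) * derivative (eulerPolyC k) =
      eulerPolyC k + C ((k : ℂ) + 1) * (X * eulerPolyC k) + X * derivative (eulerPolyC k) -
        X * (X * derivative (eulerPolyC k)) := by
    simp only [map_add, map_natCast, map_one]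
    ring
  rw [h]
  obtain ⟨c, hc⟩ : ∃ c : ℂ, c = k + 1 := ⟨_, rfl⟩
  rw [← hc]
  ext s
  rcases s with _ | _ | s
  · simp [coeff_eulerPolyC, eulerCoeffC_zero]
  · simp [coeff_eulerPolyC, coeff_derivative, eulerCoeffC_succ_succ]
    rw [hc]
    ring
  · simp [coeff_eulerPolyC, coeff_derivative, eulerCoeffC_succ_succ]
    rw [hc]
    ring

/-- The Euler–Frobenius polynomials over `ℝ`, defined by their differential recurrence. -/
noncomputable def eulerPolyR : ℕ → ℝ[X]
  | 0 => 1
  | k + 1 => (1 + ((k : ℝ[X]) + 1) * X) * eulerPolyR k + X * (1 - X) * derivative (eulerPolyR k)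

theorem map_eulerPolyR (k : ℕ) : (eulerPolyR k).map (algebraMap ℝ ℂ) = eulerPolyC k := by
  induction k with
  | zero => simp [eulerPolyR, eulerPolyC_zero]
  | succ k ih =>
    rw [eulerPolyC_succ, ← ih, eulerPolyR, derivative_map]
    simp

/-- The polynomials `x E_k(x) / (1 - x) ^ (k + 2)` in the variable `y = 1 / (1 - x)`. -/
noncomputable def eulerPolyInv : ℕ → ℝ[X]
  | 0 => X * (X - 1)
  | k + 1 => X * (X - 1) * derivative (eulerPolyInv k)

theorem eval_eulerPolyInv (k : ℕ) {y : ℝ} (hy : y ≠ 0) :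
    (eulerPolyInv k).eval y = y ^ (k + 1) * (y - 1) * (eulerPolyR k).eval (1 - y⁻¹) := by
  induction k generalizing y with
  | zero => simp [eulerPolyInv, eulerPolyR]
  | succ k ih =>
    have hinner : HasDerivAt (fun z : ℝ => 1 - z⁻¹) ((y ^ 2)⁻¹) y := by
      simpa using (hasDerivAt_inv hy).const_sub 1
    have h := (((hasDerivAt_id y).pow (k + 1)).mul ((hasDerivAt_id y).sub_const 1)).mul
      (((eulerPolyR k).hasDerivAt (1 - y⁻¹)).comp y hinner)
    have heq : (fun z => (eulerPolyInv k).eval z) =ᶠ[nhds y]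
        fun z => z ^ (k + 1) * (z - 1) * (eulerPolyR k).eval (1 - z⁻¹) := by
      filter_upwards [isOpen_ne.mem_nhds hy] with z hz using ih hz
    have h' := ((eulerPolyInv k).hasDerivAt y).unique (h.congr_of_eventuallyEq heq)
    simp only [eulerPolyInv, eulerPolyR, eval_mul, eval_X, eval_sub, eval_one, h', eval_add,
      eval_natCast]
    simp
    field_simp
    ring

theorem eulerPolyInv_ne_zero (k : ℕ) : eulerPolyInv k ≠ 0 := by
  have hX : (X * (X - 1) : ℝ[X]) ≠ 0 := mul_ne_zero X_ne_zero (X_sub_C_ne_zero 1)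
  have hdeg : (X * (X - 1) : ℝ[X]).natDegree = 2 := by compute_degree!
  suffices h : (eulerPolyInv k).natDegree = k + 2 from fun h0 => by simp [h0] at h
  induction k with
  | zero => exact hdeg
  | succ k ih =>
    have hd : (derivative (eulerPolyInv k)).natDegree = k + 1 := by
      rw [natDegree_derivative, ih]; rfl
    rw [eulerPolyInv, natDegree_mul hX (fun h0 => by simp [h0] at hd), hdeg, hd]
    ring

theorem add_two_le_card_roots_eulerPolyInv (k : ℕ) :
    k + 2 ≤ (eulerPolyInv k).roots.toFinset.card := by
  have hroot : ∀ k, (eulerPolyInv k).IsRoot 0 ∧ (eulerPolyInv k).IsRoot 1 := by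
    rintro (_ | k) <;> simp [eulerPolyInv]
  have hmem : ∀ k, 0 ∈ (eulerPolyInv k).roots.toFinset ∧ 1 ∈ (eulerPolyInv k).roots.toFinset := by
    simpa [eulerPolyInv_ne_zero] using hroot
  induction k with
  | zero =>
    rw [zero_add, ← Finset.card_pair (zero_ne_one (α := ℝ))]
    refine Finset.card_le_card fun x hx => ?_
    rcases Finset.mem_insert.mp hx with rfl | hx
    · exact (hmem 0).1
    · exact Finset.mem_singleton.mp hx ▸ (hmem 0).2
  | succ k ih =>
    have hle := card_roots_toFinset_le_card_roots_derivative_sdiff_roots_succ (eulerPolyInv k)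
    set D := (derivative (eulerPolyInv k)).roots.toFinset \ (eulerPolyInv k).roots.toFinset with hD
    have h0 : (0 : ℝ) ∉ insert 1 D := by simp [hD, -Multiset.mem_toFinset, hmem k]
    have h1 : (1 : ℝ) ∉ D := by simp [hD, -Multiset.mem_toFinset, hmem k]
    have hsub : insert 0 (insert 1 D) ⊆ (eulerPolyInv (k + 1)).roots.toFinset := by
      refine Finset.insert_subset (hmem _).1 (Finset.insert_subset (hmem _).2 fun x hx => ?_)
      have hx' := isRoot_of_mem_roots (Multiset.mem_toFinset.mp (Finset.mem_sdiff.mp hx).1)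
      rw [Multiset.mem_toFinset, mem_roots (eulerPolyInv_ne_zero _), IsRoot, eulerPolyInv, eval_mul,
        hx'.eq_zero, mul_zero]
    have := Finset.card_le_card hsub
    rw [Finset.card_insert_of_notMem h0, Finset.card_insert_of_notMem h1] at this
    omega

theorem card_roots_toFinset_eulerPolyC (k : ℕ) : (eulerPolyC k).roots.toFinset.card = k := by
  apply le_antisymm
  · exact (Multiset.toFinset_card_le _).trans
      ((card_roots' _).trans (natDegree_eulerPolyC k).le)
  · set S := (eulerPolyInv k).roots.toFinset \ {0, 1} with hS
    have hk : k ≤ S.card := by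
      have h : (eulerPolyInv k).roots.toFinset.card - ({0, 1} : Finset ℝ).card ≤ S.card :=
        Finset.le_card_sdiff _ _
      rw [Finset.card_pair (zero_ne_one (α := ℝ))] at h
      have := add_two_le_card_roots_eulerPolyInv k
      omega
    refine hk.trans (Finset.card_le_card_of_injOn (fun y => ((1 - y⁻¹ : ℝ) : ℂ)) ?_ ?_)
    · intro y hy
      simp only [hS, Finset.coe_sdiff, Set.mem_sdiff, Finset.mem_coe, Multiset.mem_toFinset,
        Finset.mem_insert, Finset.mem_singleton, not_or] at hy
      obtain ⟨hroot, hy0, hy1⟩ := hy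
      have h := (isRoot_of_mem_roots hroot).eq_zero
      rw [eval_eulerPolyInv k hy0, mul_eq_zero,
        or_iff_right (mul_ne_zero (pow_ne_zero _ hy0) (sub_ne_zero.mpr hy1))] at h
      rw [Finset.mem_coe, Multiset.mem_toFinset, mem_roots (monic_eulerPolyC k).ne_zero, IsRoot,
        ← map_eulerPolyR]
      exact (eval_map_algebraMap _ _).trans
        ((aeval_algebraMap_apply_eq_algebraMap_eval _ _).trans ((congrArg (algebraMap ℝ ℂ) h).trans (map_zero _)))
    · intro x _ y _ hxy
      simpa using hxy

theorem eulerPolyC_eq_prod (k : ℕ) :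
    eulerPolyC k = ∏ μ ∈ (eulerPolyC k).roots.toFinset, (X - C μ) := by
  have hcard : (eulerPolyC k).roots.card = (eulerPolyC k).natDegree := by
    refine le_antisymm (card_roots' _) ?_
    rw [natDegree_eulerPolyC]
    exact (card_roots_toFinset_eulerPolyC k).ge.trans (Multiset.toFinset_card_le _)
  have hnodup : (eulerPolyC k).roots.Nodup := by
    rw [← Multiset.dedup_eq_self]
    refine Multiset.eq_of_le_of_card_le (Multiset.dedup_le _) ?_
    rw [hcard, natDegree_eulerPolyC]
    exact (card_roots_toFinset_eulerPolyC k).ge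
  conv_lhs => rw [← prod_multiset_X_sub_C_of_monic_of_roots_card_eq (monic_eulerPolyC k) hcard]
  rw [Finset.prod, Multiset.toFinset_val, hnodup.dedup]

theorem eval_zero_eulerPolyC (k : ℕ) : (eulerPolyC k).eval 0 = 1 := by
  rw [← coeff_zero_eq_eval_zero, coeff_eulerPolyC, eulerCoeffC_zero]

/-- Lagrange interpolation as a partial fraction expansion. -/
theorem eval_div_eval_nodal {F : Type*} [Field F] [DecidableEq F] {s : Finset F} {R : F[X]}
    (hR : R.degree < s.card) {x : F} (hx : x ∉ s) :
    R.eval x / (Lagrange.nodal s id).eval x =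
      ∑ μ ∈ s, R.eval μ / ((derivative (Lagrange.nodal s id)).eval μ * (x - μ)) := by
  have hne : ∀ μ ∈ s, x ≠ id μ := fun μ hμ h => hx (h ▸ hμ)
  conv_lhs => rw [Lagrange.eq_interpolate (v := id) Function.injective_id.injOn hR]
  rw [Lagrange.eval_interpolate_not_at_node _ hne,
    mul_div_cancel_left₀ _ (Lagrange.eval_nodal_not_at_node hne)]
  refine Finset.sum_congr rfl fun μ hμ => ?_
  rw [Lagrange.nodalWeight_eq_eval_derivative_nodal hμ, div_eq_mul_inv, mul_inv]
  simp only [id]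
  ring

theorem degree_X_sub_one_pow_sub_lt (k : ℕ) :
    ((X - 1) ^ (k + 3) -
      X * eulerPolyC (k + 1) * (X - C ((k : ℂ) + 3 + eulerCoeffC (k + 1) k))).degree <
      ((k + 2 : ℕ) : WithBot ℕ) := by
  rw [degree_lt_iff_coeff_zero]
  intro j hj
  obtain ⟨j, rfl⟩ : ∃ i, j = i + 2 := ⟨j - 2, by omega⟩
  have hpow : ((X - 1 : ℂ[X]) ^ (k + 3)).coeff (j + 2) =
      (-1) ^ (k + 3 - (j + 2)) * ((k + 3).choose (j + 2) : ℂ) := by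
    have := coeff_X_add_C_pow (-1 : ℂ) (k + 3) (j + 2)
    rwa [map_neg, map_one, ← sub_eq_add_neg] at this
  rw [coeff_sub, hpow, coeff_mul_X_sub_C, coeff_X_mul, coeff_X_mul, coeff_eulerPolyC,
    coeff_eulerPolyC]
  rcases Nat.lt_trichotomy j (k + 1) with h | rfl | h
  · obtain rfl : j = k := by omega
    rw [eulerCoeffC_self, Nat.choose_succ_self_right]
    simp
    ring
  · rw [eulerCoeffC_self, eulerCoeffC_eq_zero_of_lt (Nat.lt_succ_self _)]
    simp
  · rw [eulerCoeffC_eq_zero_of_lt h, eulerCoeffC_eq_zero_of_lt (by omega),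
      Nat.choose_eq_zero_of_lt (by omega)]
    simp

theorem X_sub_one_pow_div_eulerPolyC (k : ℕ) {l : ℂ} (hl : l ≠ 0)
    (hE : (eulerPolyC (k + 1)).eval l ≠ 0) :
    (l - 1) ^ (k + 3) / (l * (eulerPolyC (k + 1)).eval l) =
      l - (k + 3) - eulerCoeffC (k + 1) k + (-1) ^ (k + 3) / l +
        ∑ μ ∈ (eulerPolyC (k + 1)).roots.toFinset,
          (μ - 1) ^ (k + 3) /
            (μ * (derivative (eulerPolyC (k + 1))).eval μ * (l - μ)) := by
  set E := eulerPolyC (k + 1) with hEdef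
  set S := E.roots.toFinset with hS
  have hE0 : E ≠ 0 := (monic_eulerPolyC _).ne_zero
  have hSroot : ∀ μ, μ ∈ S ↔ E.eval μ = 0 := fun μ => by
    rw [hS, Multiset.mem_toFinset, mem_roots hE0, IsRoot]
  have h0S : (0 : ℂ) ∉ S := by simp [hSroot, hEdef, eval_zero_eulerPolyC]
  have hnodal : Lagrange.nodal (insert 0 S) id = X * E := by
    rw [Lagrange.nodal, Finset.prod_insert h0S, hEdef, eulerPolyC_eq_prod]
    simp [hS, hEdef]
  have hcard : (insert 0 S).card = k + 2 := by
    rw [Finset.card_insert_of_notMem h0S, card_roots_toFinset_eulerPolyC]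
  have hlS : l ∉ insert 0 S := by simp [hl, hSroot, hE]
  have hdeg := degree_X_sub_one_pow_sub_lt k
  rw [← hcard] at hdeg
  have key := eval_div_eval_nodal hdeg hlS
  rw [hnodal, Finset.sum_insert h0S] at key
  have hsum : ∀ μ ∈ S, ((X - 1) ^ (k + 3) -
        X * E * (X - C ((k : ℂ) + 3 + eulerCoeffC (k + 1) k))).eval μ /
        ((derivative (X * E)).eval μ * (l - μ)) =
      (μ - 1) ^ (k + 3) / (μ * (derivative E).eval μ * (l - μ)) := fun μ hμ => by
    simp [(hSroot μ).mp hμ]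
  rw [Finset.sum_congr rfl hsum] at key
  have hE1 : E.eval 0 = 1 := eval_zero_eulerPolyC _
  simp only [eval_sub, eval_pow, eval_X, eval_one, eval_mul, eval_C, derivative_mul, derivative_X,
    eval_add, hE1, zero_mul, sub_zero, zero_sub, add_zero, one_mul] at key
  rw [sub_div, mul_div_cancel_left₀ _ (mul_ne_zero hl hE), sub_eq_iff_eq_add] at key
  rw [key]
  ring

theorem euler_partial_fraction (m : ℕ) (hm : 2 ≤ m) (l : ℂ) (hl : l ≠ 0)
    (hE : (eulerPolyC (2 * m - 2)).eval l ≠ 0) :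
    (1 - l) ^ (2 * m) / (l * (eulerPolyC (2 * m - 2)).eval l) =
      l - 2 * m - eulerCoeffC (2 * m - 2) (2 * m - 3) + 1 / l +
        ∑ μ ∈ (eulerPolyC (2 * m - 2)).roots.toFinset,
          (1 - μ) ^ (2 * m) /
            (μ * (Polynomial.derivative (eulerPolyC (2 * m - 2))).eval μ * (l - μ)) := by
  obtain ⟨k, hk⟩ : ∃ k, 2 * m = k + 3 := ⟨2 * m - 3, by omega⟩
  have heven : Even (k + 3) := hk ▸ even_two_mul m
  have hcast : (2 * m : ℂ) = k + 3 := by exact_mod_cast hk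
  rw [show 2 * m - 2 = k + 1 by omega] at hE ⊢
  rw [show 2 * m - 3 = k by omega, hcast, hk]
  have h := X_sub_one_pow_div_eulerPolyC k hl hE
  rw [heven.neg_one_pow] at h
  have hpow (z : ℂ) : (z - 1) ^ (k + 3) = (1 - z) ^ (k + 3) := by rw [← neg_sub, heven.neg_pow]
  simpa only [hpow] using h
end
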